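/- arXiv:1809.09893 — 8 statements merged into one kernel-verified Lean document; each statement's English description precedes it below -/
import Mathlib

section
/- Let 0 < r < R and 0 < r_* < R_*, and let f be a C^1 homeomorphism from the open annulus A(r,R) onto the open annulus A(r_*,R_*) in ℝ³. Then ∫_{A(r,R)} ‖Df(x)‖²/|f(x)|² dx ≥ 4π( 2(R−r) + rR (log(R_*/r_*))²/(R−r) ). -/
open MeasureTheory Set
open scoped ENNReal RealInnerProductSpace

noncomputable section

abbrev E3 := EuclideanSpace ℝ (Fin 3)

/-- The open spherical annulus `{x : a < |x| < b}` in `ℝ³`. -/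
def ann (a b : ℝ) : Set E3 := {x | a < ‖x‖ ∧ ‖x‖ < b}

/-- Squared Frobenius (Hilbert–Schmidt) norm of a linear map on `ℝ³`. -/
def frobSq (L : E3 →L[ℝ] E3) : ℝ := ∑ i : Fin 3, ‖L (EuclideanSpace.single i 1)‖ ^ 2

theorem isOpen_ann (a b : ℝ) : IsOpen (ann a b) :=
  (isOpen_lt continuous_const continuous_norm).inter (isOpen_lt continuous_norm continuous_const)

theorem smul_mem_ann {a b t : ℝ} (ha : 0 ≤ a) (ht : t ∈ Ioo a b) {w : E3} (hw : ‖w‖ = 1) :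
    t • w ∈ ann a b := by
  simpa [ann, norm_smul, hw, abs_of_pos (ha.trans_lt ht.1)] using ht

theorem isPreconnected_ann {a b : ℝ} (ha : 0 ≤ a) : IsPreconnected (ann a b) := by
  have hS : IsPreconnected (Metric.sphere (0 : E3) 1) := by
    refine isPreconnected_sphere ?_ _ _
    rw [← Module.finrank_eq_rank, finrank_euclideanSpace_fin]
    norm_num
  have h := ((isPreconnected_Ioo (a := a) (b := b)).prod hS).image
    (fun p : ℝ × E3 => p.1 • p.2) (by fun_prop)
  convert h using 1
  ext x
  constructor
  · intro hx
    have hx0 : 0 < ‖x‖ := ha.trans_lt hx.1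
    refine ⟨(‖x‖, ‖x‖⁻¹ • x), ⟨hx, ?_⟩, ?_⟩
    · simp [norm_smul, hx0.ne']
    · simp [smul_smul, hx0.ne']
  · rintro ⟨⟨t, w⟩, ⟨ht, hw⟩, rfl⟩
    exact smul_mem_ann ha ht (by simpa using hw)

theorem isCompact_closedShell (a b : ℝ) : IsCompact {x : E3 | a ≤ ‖x‖ ∧ ‖x‖ ≤ b} := by
  refine (isCompact_closedBall (0 : E3) b).of_isClosed_subset ?_ fun x hx => by simpa using hx.2
  exact (isClosed_le continuous_const continuous_norm).inter
    (isClosed_le continuous_norm continuous_const)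

/-- `F` tends to `c` at the inner boundary of `ann a b` and to `d` at the outer boundary, from
inside `(c, d)`. -/
def RespectsEnds (a b c d : ℝ) (F : E3 → ℝ) : Prop :=
  (∀ p > c, ∃ δ > a, ∀ x ∈ ann a b, ‖x‖ < δ → F x < p) ∧
    ∀ q < d, ∃ δ < b, ∀ x ∈ ann a b, δ < ‖x‖ → q < F x

/-- A preconnected set of values avoiding a closed interval lies on one side of it. -/
theorem IsPreconnected.lt_or_gt_of_notMem_Icc {X : Type*} [TopologicalSpace X] {S : Set X}
    (hS : IsPreconnected S) {F : X → ℝ} (hF : ContinuousOn F S) {p q : ℝ} (hpq : p ≤ q)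
    (h : ∀ x ∈ S, F x ∉ Icc p q) : (∀ x ∈ S, F x < p) ∨ ∀ x ∈ S, q < F x := by
  by_contra! hcon
  obtain ⟨⟨x, hx, hpx⟩, y, hy, hyq⟩ := hcon
  have hqx : q < F x := by
    by_contra! h'
    exact h x hx ⟨hpx, h'⟩
  have hyp : F y < p := by
    by_contra! h'
    exact h y hy ⟨h', hyq⟩
  obtain ⟨z, hz, hzp⟩ := (hS.image F hF).ordConnected.out (mem_image_of_mem F hy)
    (mem_image_of_mem F hx) ⟨hyp.le, hpq.trans hqx.le⟩
  exact h z hz ⟨hzp.ge, hzp.trans_le hpq⟩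

/-- If `F` is below `p` near both ends of an annulus, it is bounded away from `d`. -/
theorem exists_lt_forall_le_of_ends {a b c d δ₁ δ₂ p : ℝ} {F : E3 → ℝ}
    (hF : ContinuousOn F (ann a b)) (hmaps : MapsTo F (ann a b) (Ioo c d))
    (h₁ : a < δ₁) (h₂ : δ₂ < b) (hp : p < d)
    (hin : ∀ x ∈ ann a b, ‖x‖ < δ₁ → F x < p) (hout : ∀ x ∈ ann a b, δ₂ < ‖x‖ → F x < p) :
    ∃ M < d, ∀ x ∈ ann a b, F x ≤ M := by
  have hsub : {x : E3 | δ₁ ≤ ‖x‖ ∧ ‖x‖ ≤ δ₂} ⊆ ann a b :=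
    fun x hx => ⟨h₁.trans_le hx.1, hx.2.trans_lt h₂⟩
  have key : ∃ M < d, ∀ x : E3, δ₁ ≤ ‖x‖ ∧ ‖x‖ ≤ δ₂ → F x ≤ M := by
    rcases {x : E3 | δ₁ ≤ ‖x‖ ∧ ‖x‖ ≤ δ₂}.eq_empty_or_nonempty with he | hne
    · exact ⟨p, hp, fun x hx => absurd (he ▸ hx : x ∈ (∅ : Set E3)) (notMem_empty x)⟩
    · obtain ⟨z, hz, hmax⟩ := (isCompact_closedShell δ₁ δ₂).exists_isMaxOn hne (hF.mono hsub)
      exact ⟨F z, (hmaps (hsub hz)).2, fun x hx => hmax hx⟩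
  obtain ⟨M, hM, hle⟩ := key
  refine ⟨max M p, max_lt hM hp, fun x hx => ?_⟩
  by_cases hx1 : ‖x‖ < δ₁
  · exact (hin x hx hx1).le.trans (le_max_right _ _)
  by_cases hx2 : δ₂ < ‖x‖
  · exact (hout x hx hx2).le.trans (le_max_right _ _)
  · exact (hle x ⟨not_lt.1 hx1, not_lt.1 hx2⟩).trans (le_max_left _ _)

/-- `F` is below `p` near the inner end of the annulus and above `q` near the outer end. -/
def SeparatesEnds (a b : ℝ) (F : E3 → ℝ) (p q : ℝ) : Prop :=
  (∃ δ > a, ∀ x ∈ ann a b, ‖x‖ < δ → F x < p) ∧ ∃ δ < b, ∀ x ∈ ann a b, δ < ‖x‖ → q < F x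

/-- `F` leaves every compact subinterval of `(c, d)` near the boundary of the annulus. -/
def ProperOnAnn (a b c d : ℝ) (F : E3 → ℝ) : Prop :=
  ∀ p ∈ Ioo c d, ∀ q ∈ Ioo c d, p ≤ q → ∃ δ₁ > a, ∃ δ₂ < b,
    ∀ x ∈ ann a b, ‖x‖ < δ₁ ∨ δ₂ < ‖x‖ → F x ∉ Icc p q

theorem ProperOnAnn.separatesEnds {a b c d : ℝ} (ha : 0 ≤ a) {F : E3 → ℝ}
    (hprop : ProperOnAnn a b c d F)
    (hF : ContinuousOn F (ann a b)) (hmaps : MapsTo F (ann a b) (Ioo c d))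
    (hsurj : SurjOn F (ann a b) (Ioo c d)) {p q : ℝ} (hp : p ∈ Ioo c d) (hq : q ∈ Ioo c d)
    (hpq : p ≤ q) :
    SeparatesEnds a b F p q ∨ SeparatesEnds a b (fun x => c + d - F x) (c + d - q) (c + d - p) := by
  obtain ⟨δ₁, h₁, δ₂, h₂, hav⟩ := hprop p hp q hq hpq
  have hsub₁ : {x ∈ ann a b | ‖x‖ < δ₁} = ann a (min b δ₁) := by
    ext x; simp [ann, and_assoc]
  have hsub₂ : {x ∈ ann a b | δ₂ < ‖x‖} = ann (max a δ₂) b := by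
    ext x; simp only [ann, mem_ofPred_eq, max_lt_iff]; tauto
  have hin := (hsub₁ ▸ isPreconnected_ann ha :
    IsPreconnected {x ∈ ann a b | ‖x‖ < δ₁}).lt_or_gt_of_notMem_Icc
      (hF.mono (sep_subset _ _)) hpq fun x hx => hav x hx.1 (Or.inl hx.2)
  have hout := (hsub₂ ▸ isPreconnected_ann (ha.trans (le_max_left _ _)) :
    IsPreconnected {x ∈ ann a b | δ₂ < ‖x‖}).lt_or_gt_of_notMem_Icc
      (hF.mono (sep_subset _ _)) hpq fun x hx => hav x hx.1 (Or.inr hx.2)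
  rcases hin with hin | hin <;> rcases hout with hout | hout
  · obtain ⟨M, hM, hle⟩ := exists_lt_forall_le_of_ends hF hmaps h₁ h₂ hp.2
      (fun x hx h => hin x ⟨hx, h⟩) (fun x hx h => hout x ⟨hx, h⟩)
    obtain ⟨y, hy1, hy2⟩ := exists_between (max_lt hM hp.2)
    obtain ⟨x, hx, rfl⟩ := hsurj ⟨hp.1.trans ((le_max_right _ _).trans_lt hy1), hy2⟩
    exact absurd (hle x hx) (not_le.2 ((le_max_left _ _).trans_lt hy1))
  · exact Or.inl ⟨⟨δ₁, h₁, fun x hx h => hin x ⟨hx, h⟩⟩, δ₂, h₂, fun x hx h => hout x ⟨hx, h⟩⟩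
  · refine Or.inr ⟨⟨δ₁, h₁, fun x hx h => ?_⟩, δ₂, h₂, fun x hx h => ?_⟩
    · linarith [hin x ⟨hx, h⟩]
    · linarith [hout x ⟨hx, h⟩]
  · obtain ⟨M, hM, hle⟩ := exists_lt_forall_le_of_ends (c := -d) (d := -c) (p := -q) hF.neg
      (fun x hx => ⟨neg_lt_neg (hmaps hx).2, neg_lt_neg (hmaps hx).1⟩) h₁ h₂ (neg_lt_neg hq.1)
      (fun x hx h => neg_lt_neg (hin x ⟨hx, h⟩)) (fun x hx h => neg_lt_neg (hout x ⟨hx, h⟩))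
    obtain ⟨y, hy1, hy2⟩ := exists_between (max_lt hM (neg_lt_neg hq.1))
    obtain ⟨x, hx, hxy⟩ := hsurj (show -y ∈ Ioo c d from
      ⟨by linarith, by linarith [(le_max_right M (-q)).trans_lt hy1, hq.2]⟩)
    have := hle x hx
    have := (le_max_left M (-q)).trans_lt hy1
    simp only [Pi.neg_apply] at *
    linarith

theorem ProperOnAnn.respectsEnds_of_separatesEnds {a b c d : ℝ} (ha : 0 ≤ a) (hab : a < b)
    {F : E3 → ℝ} (hprop : ProperOnAnn a b c d F)
    (hF : ContinuousOn F (ann a b)) (hmaps : MapsTo F (ann a b) (Ioo c d))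
    (hsurj : SurjOn F (ann a b) (Ioo c d)) {m : ℝ} (hm : m ∈ Ioo c d)
    (hsep : SeparatesEnds a b F m m) : RespectsEnds a b c d F := by
  have key : ∀ p ∈ Ioo c d, ∀ q ∈ Ioo c d, p ≤ m → m ≤ q → SeparatesEnds a b F p q := by
    intro p hp q hq hpm hmq
    refine (hprop.separatesEnds ha hF hmaps hsurj hp hq (hpm.trans hmq)).resolve_right ?_
    rintro ⟨⟨δ, hδ, h⟩, -⟩
    obtain ⟨⟨δ', hδ', h'⟩, -⟩ := hsep
    obtain ⟨t, ht1, ht2⟩ := exists_between (lt_min (lt_min hδ hδ') hab)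
    obtain ⟨e, he⟩ : ∃ e : E3, ‖e‖ = 1 := ⟨EuclideanSpace.single 0 1, by simp⟩
    have hx := smul_mem_ann ha ⟨ht1, ht2.trans_le (min_le_right _ _)⟩ he
    have hn : ‖t • e‖ = t := by simp [norm_smul, he, abs_of_pos (ha.trans_lt ht1)]
    have h1 := h _ hx (hn.trans_lt <| ht2.trans_le ((min_le_left _ _).trans (min_le_left _ _)))
    have h2 := h' _ hx (hn.trans_lt <| ht2.trans_le ((min_le_left _ _).trans (min_le_right _ _)))
    linarith
  constructor
  · intro p hp
    obtain ⟨p', hp1, hp2⟩ := exists_between (lt_min hp hm.1)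
    have hp3 := (hp2.trans_le (min_le_right _ _))
    obtain ⟨⟨δ, hδ, h⟩, -⟩ := key p' ⟨hp1, hp3.trans hm.2⟩ m hm hp3.le le_rfl
    exact ⟨δ, hδ, fun x hx hxδ => (h x hx hxδ).trans (hp2.trans_le (min_le_left _ _))⟩
  · intro q hq
    obtain ⟨q', hq1, hq2⟩ := exists_between (max_lt hq hm.2)
    have hq3 := ((le_max_right _ _).trans_lt hq1)
    obtain ⟨-, δ, hδ, h⟩ := key m hm q' ⟨hm.1.trans hq3, hq2⟩ le_rfl hq3.le
    exact ⟨δ, hδ, fun x hx hxδ => ((le_max_left _ _).trans_lt hq1).trans (h x hx hxδ)⟩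

theorem ProperOnAnn.reflect {a b c d : ℝ} {F : E3 → ℝ} (hprop : ProperOnAnn a b c d F) :
    ProperOnAnn a b c d fun x => c + d - F x := by
  intro p hp q hq hpq
  obtain ⟨δ₁, h₁, δ₂, h₂, h⟩ := hprop (c + d - q) ⟨by linarith [hq.2], by linarith [hq.1]⟩
    (c + d - p) ⟨by linarith [hp.2], by linarith [hp.1]⟩ (by linarith)
  exact ⟨δ₁, h₁, δ₂, h₂, fun x hx hx' hmem =>
    h x hx hx' ⟨by linarith [hmem.2], by linarith [hmem.1]⟩⟩

theorem ProperOnAnn.respectsEnds_or {a b c d : ℝ} (ha : 0 ≤ a) (hab : a < b) (hcd : c < d)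
    {F : E3 → ℝ} (hprop : ProperOnAnn a b c d F)
    (hF : ContinuousOn F (ann a b)) (hmaps : MapsTo F (ann a b) (Ioo c d))
    (hsurj : SurjOn F (ann a b) (Ioo c d)) :
    RespectsEnds a b c d F ∨ RespectsEnds a b c d fun x => c + d - F x := by
  have hm : (c + d) / 2 ∈ Ioo c d := ⟨by linarith, by linarith⟩
  refine (hprop.separatesEnds ha hF hmaps hsurj hm hm le_rfl).imp
    (hprop.respectsEnds_of_separatesEnds ha hab hF hmaps hsurj hm) fun h => ?_
  rw [show c + d - (c + d) / 2 = (c + d) / 2 by ring] at h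
  refine hprop.reflect.respectsEnds_of_separatesEnds ha hab (continuousOn_const.sub hF)
    (fun x hx => ?_) (fun y hy => ?_) hm h
  · have := hmaps hx
    exact ⟨by linarith [this.2], by linarith [this.1]⟩
  · obtain ⟨x, hx, hxy⟩ := hsurj (show c + d - y ∈ Ioo c d from
      ⟨by linarith [hy.2], by linarith [hy.1]⟩)
    exact ⟨x, hx, by simp [hxy]⟩

/-- A homeomorphism between annuli either preserves or exchanges the two boundary components. -/
theorem respectsEnds_or_of_homeomorph {a b c d : ℝ} (ha : 0 ≤ a) (hab : a < b) (hc : 0 ≤ c)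
    (hcd : c < d) {f g : E3 → E3} (hf : ContinuousOn f (ann a b)) (hg : ContinuousOn g (ann c d))
    (hfm : MapsTo f (ann a b) (ann c d)) (hgm : MapsTo g (ann c d) (ann a b))
    (hgf : ∀ x ∈ ann a b, g (f x) = x) (hfg : ∀ y ∈ ann c d, f (g y) = y) :
    RespectsEnds a b c d (fun x => ‖f x‖) ∨ RespectsEnds a b c d fun x => c + d - ‖f x‖ := by
  obtain ⟨e, he⟩ : ∃ e : E3, ‖e‖ = 1 := ⟨EuclideanSpace.single 0 1, by simp⟩
  have hn : ∀ t ∈ Ioo c d, ‖t • e‖ = t := fun t ht => by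
    simp [norm_smul, he, abs_of_pos (hc.trans_lt ht.1)]
  refine ProperOnAnn.respectsEnds_or ha hab hcd ?_ hf.norm (fun x hx => hfm hx) fun t ht => ?_
  · intro p hp q hq hpq
    have hsub : {y : E3 | p ≤ ‖y‖ ∧ ‖y‖ ≤ q} ⊆ ann c d :=
      fun y hy => ⟨hp.1.trans_le hy.1, hy.2.trans_lt hq.2⟩
    have hne : {y : E3 | p ≤ ‖y‖ ∧ ‖y‖ ≤ q}.Nonempty := ⟨p • e, by simp [hn p hp, hpq]⟩
    have hcont := (hg.mono hsub).norm
    obtain ⟨y₁, hy₁, hmin⟩ := (isCompact_closedShell p q).exists_isMinOn hne hcont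
    obtain ⟨y₂, hy₂, hmax⟩ := (isCompact_closedShell p q).exists_isMaxOn hne hcont
    refine ⟨‖g y₁‖, (hgm (hsub hy₁)).1, ‖g y₂‖, (hgm (hsub hy₂)).2, ?_⟩
    rintro x hx (h | h) hmem
    · have := hmin (show f x ∈ _ from hmem)
      simp only [mem_ofPred_eq, hgf x hx] at this
      linarith
    · have := hmax (show f x ∈ _ from hmem)
      simp only [mem_ofPred_eq, hgf x hx] at this
      linarith
  · have := smul_mem_ann hc ht he
    exact ⟨g (t • e), hgm this, by simp [hfg _ this, hn t ht]⟩

theorem exists_orthonormalBasis_zero_eq {w : E3} (hw : ‖w‖ = 1) :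
    ∃ e : OrthonormalBasis (Fin 3) ℝ E3, e 0 = w := by
  obtain ⟨e, he⟩ := Orthonormal.exists_orthonormalBasis_extension_of_card_eq (𝕜 := ℝ) (E := E3)
    (ι := Fin 3) (by simp) (v := fun _ => w) (s := {0})
    ⟨fun _ => hw, fun i j hij => absurd (Subsingleton.elim i j) hij⟩
  exact ⟨e, he 0 rfl⟩

/-- The Frobenius norm may be computed in any orthonormal basis. -/
theorem frobSq_eq_sum (L : E3 →L[ℝ] E3) (e : OrthonormalBasis (Fin 3) ℝ E3) :
    frobSq L = ∑ i, ‖L (e i)‖ ^ 2 := by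
  have key : ∀ u : OrthonormalBasis (Fin 3) ℝ E3,
      ∑ i, ‖L (u i)‖ ^ 2 = ∑ j, ‖ContinuousLinearMap.adjoint L (e j)‖ ^ 2 := by
    intro u
    simp_rw [← e.sum_sq_norm_inner_right (L _), ← u.sum_sq_norm_inner_right
      (ContinuousLinearMap.adjoint L _), ContinuousLinearMap.adjoint_inner_right]
    rw [Finset.sum_comm]
    simp_rw [fun i j => real_inner_comm (L (u i)) (e j)]
  rw [key e, ← key (EuclideanSpace.basisFun (Fin 3) ℝ)]
  simp [frobSq]

/-- Hadamard's inequality for a linear map in an orthonormal basis. -/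
theorem abs_det_le_prod_norm (D : E3 →ₗ[ℝ] E3) (e : OrthonormalBasis (Fin 3) ℝ E3) :
    |LinearMap.det D| ≤ ∏ i, ‖D (e i)‖ := by
  have : Fact (Module.finrank ℝ E3 = 3) := ⟨by simp⟩
  have h := e.toBasis.orientation.abs_volumeForm_apply_le (D ∘ e)
  rw [e.toBasis.orientation.volumeForm_robust' e, ← e.coe_toBasis, e.toBasis.det_comp,
    e.toBasis.det_self, mul_one] at h
  simpa using h

/-- If `D` maps radial increments to radial increments, its determinant is controlled by the
tangential derivatives. -/
theorem abs_det_le_of_inner_eq (D : E3 →ₗ[ℝ] E3) {p : E3} (hp : ‖p‖ = 1)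
    (e : OrthonormalBasis (Fin 3) ℝ E3) (h : ∀ v, ⟪p, D v⟫ = ⟪e 0, v⟫) :
    |LinearMap.det D| ≤ ‖D (e 1)‖ * ‖D (e 2)‖ := by
  set w := D (e 0) - p with hw
  set T : E3 →ₗ[ℝ] E3 := LinearMap.transvection (innerₛₗ ℝ p) (-w) with hT
  have hTv : ∀ v, T v = v - ⟪p, v⟫ • w := by
    intro v
    simp [hT, LinearMap.transvection.apply, sub_eq_add_neg]
  have hpw : ⟪p, w⟫ = 0 := by
    rw [hw, inner_sub_right, h, real_inner_self_eq_norm_sq, real_inner_self_eq_norm_sq, hp]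
    simp
  have hdet : LinearMap.det T = 1 := by
    rw [hT, LinearMap.transvection.det]
    simp [hpw]
  have hTD : ∀ v, (T ∘ₗ D) v = D v - ⟪e 0, v⟫ • w := fun v => by simp [hTv, h]
  have e0 : ⟪e 0, e 0⟫ = 1 := by simp
  have e1 : ⟪e 0, e 1⟫ = 0 := e.inner_eq_zero (by decide)
  have e2 : ⟪e 0, e 2⟫ = 0 := e.inner_eq_zero (by decide)
  have := abs_det_le_prod_norm (T ∘ₗ D) e
  rw [LinearMap.det_comp, hdet, one_mul, Fin.prod_univ_three, hTD, hTD, hTD, e0, e1, e2] at this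
  simpa [hw, hp] using this

/-- Pointwise splitting of the energy into radial and tangential contributions. -/
theorem radial_add_det_le_frobSq (L : E3 →L[ℝ] E3) {x y : E3} (hx : x ≠ 0) (hy : y ≠ 0)
    (ℓ : E3 →L[ℝ] ℝ) (D : E3 →L[ℝ] E3)
    (hD : ∀ v, D v = (‖x‖ / ‖y‖) • L v + ℓ v • y)
    (hDx : ∀ v, ⟪(‖x‖ / ‖y‖) • y, D v⟫ = ⟪x, v⟫) :
    (⟪y, L (‖x‖⁻¹ • x)⟫ / ‖y‖ ^ 2) ^ 2 + 2 * (|D.det| / ‖x‖ ^ 2) ≤ frobSq L / ‖y‖ ^ 2 := by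
  have hx' : 0 < ‖x‖ := norm_pos_iff.2 hx
  have hy' : 0 < ‖y‖ := norm_pos_iff.2 hy
  obtain ⟨e, he⟩ := exists_orthonormalBasis_zero_eq (w := ‖x‖⁻¹ • x)
    (by simp [norm_smul, hx'.ne'])
  have hdet : |D.det| ≤ ‖D (e 1)‖ * ‖D (e 2)‖ := by
    refine abs_det_le_of_inner_eq (D : E3 →ₗ[ℝ] E3) (p := ‖y‖⁻¹ • y)
      (by simp [norm_smul, hy'.ne']) e fun v => ?_
    have := hDx v
    rw [real_inner_smul_left] at this
    rw [he, real_inner_smul_left, real_inner_smul_left, ContinuousLinearMap.coe_coe, ← this]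
    field_simp
  have hbound : ∀ i, ⟪e 0, e i⟫ = 0 → ‖D (e i)‖ ≤ ‖x‖ / ‖y‖ * ‖L (e i)‖ := by
    intro i hi
    have h0 : ⟪D (e i), y⟫ = 0 := by
      have := hDx (e i)
      rw [he, real_inner_smul_left] at hi
      rw [(mul_eq_zero.1 hi).resolve_left (inv_ne_zero hx'.ne'), real_inner_smul_left] at this
      rw [real_inner_comm]
      exact (mul_eq_zero.1 this).resolve_left (by positivity)
    have h1 : ‖D (e i)‖ * ‖D (e i)‖ ≤ ‖D (e i)‖ * (‖x‖ / ‖y‖ * ‖L (e i)‖) := by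
      calc ‖D (e i)‖ * ‖D (e i)‖ = ⟪D (e i), (‖x‖ / ‖y‖) • L (e i) + ℓ (e i) • y⟫ := by
            rw [← hD, real_inner_self_eq_norm_mul_norm]
        _ = (‖x‖ / ‖y‖) * ⟪D (e i), L (e i)⟫ := by
            rw [inner_add_right, real_inner_smul_right, real_inner_smul_right, h0]; ring
        _ ≤ (‖x‖ / ‖y‖) * (‖D (e i)‖ * ‖L (e i)‖) := by
            gcongr; exact real_inner_le_norm _ _
        _ = _ := by ring
    rcases (norm_nonneg (D (e i))).eq_or_lt with h | h
    · rw [← h]; positivity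
    · exact le_of_mul_le_mul_left h1 h
  have hdet' : |D.det| / ‖x‖ ^ 2 ≤ ‖L (e 1)‖ * ‖L (e 2)‖ / ‖y‖ ^ 2 := by
    rw [div_le_iff₀ (by positivity)]
    calc |D.det| ≤ _ := hdet
      _ ≤ (‖x‖ / ‖y‖ * ‖L (e 1)‖) * (‖x‖ / ‖y‖ * ‖L (e 2)‖) := by
          gcongr
          · exact hbound 1 (e.inner_eq_zero (by decide))
          · exact hbound 2 (e.inner_eq_zero (by decide))
      _ = _ := by field_simp
  have hrad : (⟪y, L (‖x‖⁻¹ • x)⟫ / ‖y‖ ^ 2) ^ 2 ≤ ‖L (e 0)‖ ^ 2 / ‖y‖ ^ 2 := by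
    have h := abs_real_inner_le_norm y (L (‖x‖⁻¹ • x))
    rw [← he] at h ⊢
    rw [div_pow, ← sq_abs, div_le_div_iff₀ (by positivity) (by positivity)]
    calc |⟪y, L (e 0)⟫| ^ 2 * ‖y‖ ^ 2 ≤ (‖y‖ * ‖L (e 0)‖) ^ 2 * ‖y‖ ^ 2 := by gcongr
      _ = _ := by ring
  rw [frobSq_eq_sum L e, Fin.sum_univ_three, add_div, add_div]
  have h3 : 2 * (‖L (e 1)‖ * ‖L (e 2)‖ / ‖y‖ ^ 2)
      ≤ ‖L (e 1)‖ ^ 2 / ‖y‖ ^ 2 + ‖L (e 2)‖ ^ 2 / ‖y‖ ^ 2 := by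
    rw [← mul_div_assoc, ← add_div]
    gcongr
    nlinarith [sq_nonneg (‖L (e 1)‖ - ‖L (e 2)‖)]
  linarith

theorem toSphere_univ_eq :
    (volume : Measure E3).toSphere univ = ENNReal.ofReal (4 * Real.pi) := by
  rw [Measure.toSphere_apply_univ, EuclideanSpace.volume_ball_fin_three]
  simp only [finrank_euclideanSpace, Fintype.card_fin, ENNReal.ofReal_one, one_pow, one_mul]
  rw [← ENNReal.ofReal_natCast, ← ENNReal.ofReal_mul (by positivity)]
  congr 1
  push_cast
  ring

/-- Integration in polar coordinates on `ℝ³`. -/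
theorem lintegral_eq_lintegral_sphere {h : E3 → ℝ≥0∞} (hh : Measurable h) :
    ∫⁻ x, h x = ∫⁻ w : Metric.sphere (0 : E3) 1, ∫⁻ t in Ioi (0 : ℝ),
      ENNReal.ofReal (t ^ 2) * h (t • (w : E3)) ∂volume ∂(volume : Measure E3).toSphere := by
  have hm := (volume : Measure E3).measurePreserving_homeomorphUnitSphereProd
  have hmeas : Measurable fun p : Metric.sphere (0 : E3) 1 × Ioi (0 : ℝ) =>
      h ((p.2 : ℝ) • (p.1 : E3)) := hh.comp (by fun_prop)
  calc ∫⁻ x, h x = ∫⁻ x in {(0 : E3)}ᶜ, h x := by rw [restrict_compl_singleton]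
    _ = ∫⁻ x : ({(0 : E3)}ᶜ : Set E3), h x ∂(Measure.comap Subtype.val volume) := by
        rw [lintegral_subtype_comap (measurableSet_singleton _).compl]
    _ = ∫⁻ p, h ((p.2 : ℝ) • (p.1 : E3)) ∂((volume : Measure E3).toSphere.prod
          (.volumeIoiPow (Module.finrank ℝ E3 - 1))) := by
        rw [← hm.lintegral_comp hmeas]
        refine lintegral_congr fun x => ?_
        rw [← homeomorphUnitSphereProd_symm_apply_coe, Homeomorph.symm_apply_apply]
    _ = _ := by
        rw [lintegral_prod _ hmeas.aemeasurable]
        refine lintegral_congr fun w => ?_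
        have hw : Measurable fun t : ℝ => h (t • (w : E3)) := hh.comp (by fun_prop)
        refine (lintegral_withDensity_eq_lintegral_mul _ (by fun_prop)
          (hw.comp measurable_subtype_coe)).trans ?_
        simp only [Pi.mul_apply, finrank_euclideanSpace, Fintype.card_fin, Nat.add_one_sub_one,
          Function.comp_apply]
        exact lintegral_subtype_comap measurableSet_Ioi
          (fun t : ℝ => ENNReal.ofReal (t ^ 2) * h (t • (w : E3)))

/-- Integration over an annulus in polar coordinates. -/
theorem setLIntegral_ann_eq_lintegral_sphere {a b : ℝ} (ha : 0 ≤ a) {h : E3 → ℝ≥0∞}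
    (hh : Measurable ((ann a b).indicator h)) :
    ∫⁻ x in ann a b, h x = ∫⁻ w : Metric.sphere (0 : E3) 1, ∫⁻ t in Ioo a b,
      ENNReal.ofReal (t ^ 2) * h (t • (w : E3)) ∂volume ∂(volume : Measure E3).toSphere := by
  rw [← lintegral_indicator (isOpen_ann a b).measurableSet, lintegral_eq_lintegral_sphere hh]
  refine lintegral_congr fun w => ?_
  rw [← lintegral_indicator measurableSet_Ioi, ← lintegral_indicator measurableSet_Ioo]
  refine lintegral_congr fun t => ?_
  have hw : ‖(w : E3)‖ = 1 := by simp
  by_cases ht : t ∈ Ioo a b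
  · rw [indicator_of_mem (show t ∈ Ioi 0 from ha.trans_lt ht.1), indicator_of_mem ht,
      indicator_of_mem (smul_mem_ann ha ht hw)]
  · rw [indicator_of_notMem ht]
    by_cases ht0 : t ∈ Ioi 0
    · rw [indicator_of_mem ht0, indicator_of_notMem, mul_zero]
      intro hmem
      have h1 : ‖t • (w : E3)‖ = t := by simp [norm_smul, abs_of_pos (show 0 < t from ht0)]
      rw [ann, mem_ofPred_eq, h1] at hmem
      exact ht hmem
    · rw [indicator_of_notMem ht0]

theorem setLIntegral_ann_inv_sq {a b : ℝ} (ha : 0 ≤ a) :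
    ∫⁻ x in ann a b, ENNReal.ofReal (‖x‖ ^ 2)⁻¹ = ENNReal.ofReal (4 * Real.pi * (b - a)) := by
  rw [setLIntegral_ann_eq_lintegral_sphere ha
    ((by fun_prop : Measurable fun x : E3 => ENNReal.ofReal (‖x‖ ^ 2)⁻¹).indicator
      (isOpen_ann a b).measurableSet)]
  have key : ∀ w : Metric.sphere (0 : E3) 1, ∫⁻ t in Ioo a b,
      ENNReal.ofReal (t ^ 2) * ENNReal.ofReal (‖t • (w : E3)‖ ^ 2)⁻¹ = ENNReal.ofReal (b - a) := by
    intro w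
    rw [setLIntegral_congr_fun (g := fun _ => 1) measurableSet_Ioo]
    · simp
    · intro t ht
      have ht0 := ha.trans_lt ht.1
      simp only
      rw [← ENNReal.ofReal_mul (by positivity)]
      simp [norm_smul, ht0.ne']
  simp_rw [key]
  rw [lintegral_const, toSphere_univ_eq, mul_comm, ← ENNReal.ofReal_mul (by positivity)]

/-- A norm preserving surjection of an annulus does not decrease weighted volume, when counted with
multiplicity. -/
theorem setLIntegral_ann_le_det {a b : ℝ} {H : E3 → E3}
    (hH : ∀ x ∈ ann a b, DifferentiableAt ℝ H x) (hnorm : ∀ x ∈ ann a b, ‖H x‖ = ‖x‖)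
    (hsurj : SurjOn H (ann a b) (ann a b)) {φ : ℝ → ℝ≥0∞} (hφ : Measurable φ) :
    ∫⁻ x in ann a b, φ ‖x‖ ≤
      ∫⁻ x in ann a b, ENNReal.ofReal |(fderiv ℝ H x).det| * φ ‖x‖ := by
  have hdet : Measurable fun x => ENNReal.ofReal |(fderiv ℝ H x).det| :=
    ENNReal.measurable_ofReal.comp <| continuous_abs.measurable.comp <|
      ContinuousLinearMap.continuous_det.measurable.comp (measurable_fderiv ℝ H)
  set μ := (volume : Measure E3).restrict (ann a b) with hμ
  have hle : μ.map (fun x => ‖x‖) ≤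
      (μ.withDensity fun x => ENNReal.ofReal |(fderiv ℝ H x).det|).map fun x => ‖x‖ := by
    refine Measure.le_iff.2 fun T hT => ?_
    have hT' : MeasurableSet ((fun x : E3 => ‖x‖) ⁻¹' T) := measurable_norm hT
    rw [Measure.map_apply measurable_norm hT, Measure.map_apply measurable_norm hT,
      withDensity_apply _ hT', hμ, Measure.restrict_apply hT', Measure.restrict_restrict hT']
    refine le_trans (measure_mono ?_) (addHaar_image_le_lintegral_abs_det_fderiv volume
      (hT'.inter (isOpen_ann a b).measurableSet)
      fun x hx => (hH x hx.2).hasFDerivAt.hasFDerivWithinAt)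
    rintro y ⟨hyT, hy⟩
    obtain ⟨x, hx, rfl⟩ := hsurj hy
    exact ⟨x, ⟨by simpa [hnorm x hx] using hyT, hx⟩, rfl⟩
  have := lintegral_mono' hle (le_refl φ)
  rw [lintegral_map hφ measurable_norm, lintegral_map hφ measurable_norm] at this
  exact this.trans_eq (lintegral_withDensity_eq_lintegral_mul _ hdet (hφ.comp measurable_norm))

/-- One-dimensional lower bound for the radial energy of a function with prescribed boundary
limits. -/
theorem ofReal_sq_le_lintegral_sq_mul_deriv {a b α β : ℝ} (ha : 0 < a) (hab : a < b) {v w : ℝ → ℝ}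
    (hv : ∀ t ∈ Ioo a b, HasDerivAt v (w t) t) (hw : ContinuousOn w (Ioo a b))
    (hva : Filter.Tendsto v (nhdsWithin a (Ioi a)) (nhds α))
    (hvb : Filter.Tendsto v (nhdsWithin b (Iio b)) (nhds β)) :
    ENNReal.ofReal (a * b * (β - α) ^ 2 / (b - a)) ≤
      ∫⁻ t in Ioo a b, ENNReal.ofReal (t ^ 2) * ENNReal.ofReal (w t ^ 2) := by
  have hb := ha.trans hab
  set C := (β - α) * (a * b / (b - a)) with hC
  set V : ℝ → ℝ := fun t => 2 * C * v t + C ^ 2 / t with hV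
  have hlima : Filter.Tendsto V (nhdsWithin a (Ioi a)) (nhds (2 * C * α + C ^ 2 / a)) :=
    (hva.const_mul _).add (((continuousAt_const.div continuousAt_id ha.ne').tendsto).mono_left
      nhdsWithin_le_nhds)
  have hlimb : Filter.Tendsto V (nhdsWithin b (Iio b)) (nhds (2 * C * β + C ^ 2 / b)) :=
    (hvb.const_mul _).add (((continuousAt_const.div continuousAt_id hb.ne').tendsto).mono_left
      nhdsWithin_le_nhds)
  have hV' : ∀ t ∈ Ioo a b, HasDerivAt V (2 * C * w t - C ^ 2 / t ^ 2) t := by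
    intro t ht
    have ht0 : t ≠ 0 := (ha.trans ht.1).ne'
    have h := ((hv t ht).const_mul (2 * C)).add ((hasDerivAt_inv ht0).const_mul (C ^ 2))
    rwa [mul_neg, ← sub_eq_add_neg] at h
  have hbound : ∀ s ∈ Ioo a b, ∀ t ∈ Ioo a b, s ≤ t → ENNReal.ofReal (V t - V s) ≤
      ∫⁻ t in Ioo a b, ENNReal.ofReal (t ^ 2) * ENNReal.ofReal (w t ^ 2) := by
    intro s hs t ht hst
    have hsub : Icc s t ⊆ Ioo a b := fun u hu => ⟨hs.1.trans_le hu.1, hu.2.trans_lt ht.2⟩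
    have hcont : ContinuousOn (fun u => u ^ 2 * w u ^ 2) (Icc s t) :=
      (continuousOn_id.pow 2).mul ((hw.mono hsub).pow 2)
    have h1 : V t - V s ≤ ∫ u in s..t, u ^ 2 * w u ^ 2 := by
      refine intervalIntegral.sub_le_integral_of_hasDeriv_right_of_le hst
        (fun u hu => (hV' u (hsub hu)).continuousAt.continuousWithinAt)
        (fun u hu => (hV' u (hsub (Ioo_subset_Icc_self hu))).hasDerivWithinAt)
        hcont.integrableOn_Icc fun u hu => ?_
      have hu0 : u ≠ 0 := (ha.trans (hsub (Ioo_subset_Icc_self hu)).1).ne'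
      have : 0 ≤ (u * w u - C / u) ^ 2 := sq_nonneg _
      have e : (u * w u - C / u) ^ 2 = u ^ 2 * w u ^ 2 - (2 * C * w u - C ^ 2 / u ^ 2) := by
        field_simp
        ring
      linarith
    refine (ENNReal.ofReal_le_ofReal h1).trans ?_
    rw [intervalIntegral.integral_of_le hst, ofReal_integral_eq_lintegral_ofReal
      (hcont.integrableOn_Icc.mono_set Ioc_subset_Icc_self)
      (Filter.Eventually.of_forall fun u => by positivity)]
    refine (lintegral_mono_set (Ioc_subset_Icc_self.trans hsub)).trans_eq ?_
    exact lintegral_congr fun u => ENNReal.ofReal_mul (sq_nonneg u)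
  have hval : a * b * (β - α) ^ 2 / (b - a) =
      (2 * C * β + C ^ 2 / b) - (2 * C * α + C ^ 2 / a) := by
    have : b - a ≠ 0 := (sub_pos.2 hab).ne'
    rw [hC]
    field_simp
    ring
  obtain ⟨m, hm1, hm2⟩ := exists_between hab
  have hstep : ∀ s ∈ Ioo a m, ENNReal.ofReal ((2 * C * β + C ^ 2 / b) - V s) ≤
      ∫⁻ t in Ioo a b, ENNReal.ofReal (t ^ 2) * ENNReal.ofReal (w t ^ 2) := by
    intro s hs
    refine le_of_tendsto (ENNReal.tendsto_ofReal (hlimb.sub_const (V s))) ?_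
    filter_upwards [Ioo_mem_nhdsLT hm2] with t ht
    exact hbound s ⟨hs.1, hs.2.trans hm2⟩ t ⟨hm1.trans ht.1, ht.2⟩ (hs.2.trans ht.1).le
  rw [hval]
  refine le_of_tendsto (ENNReal.tendsto_ofReal (hlima.const_sub _)) ?_
  filter_upwards [Ioo_mem_nhdsGT hm1] with s hs using hstep s hs

theorem RespectsEnds.tendsto {a b c d : ℝ} (ha : 0 ≤ a) (hab : a < b) {F : E3 → ℝ}
    (hF : RespectsEnds a b c d F) (hmaps : MapsTo F (ann a b) (Ioo c d)) {w : E3} (hw : ‖w‖ = 1) :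
    Filter.Tendsto (fun t : ℝ => F (t • w)) (nhdsWithin a (Ioi a)) (nhds c) ∧
      Filter.Tendsto (fun t : ℝ => F (t • w)) (nhdsWithin b (Iio b)) (nhds d) := by
  have hn : ∀ t ∈ Ioo a b, ‖t • w‖ = t := fun t ht => by
    simp [norm_smul, hw, abs_of_pos (ha.trans_lt ht.1)]
  constructor
  · refine tendsto_order.2 ⟨fun p hp => ?_, fun p hp => ?_⟩
    · filter_upwards [Ioo_mem_nhdsGT hab] with t ht
      exact hp.trans (hmaps (smul_mem_ann ha ht hw)).1
    · obtain ⟨δ, hδ, h⟩ := hF.1 p hp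
      filter_upwards [Ioo_mem_nhdsGT hab, Ioo_mem_nhdsGT hδ] with t ht ht'
      exact h _ (smul_mem_ann ha ht hw) ((hn t ht).trans_lt ht'.2)
  · refine tendsto_order.2 ⟨fun q hq => ?_, fun q hq => ?_⟩
    · obtain ⟨δ, hδ, h⟩ := hF.2 q hq
      filter_upwards [Ioo_mem_nhdsLT hab, Ioo_mem_nhdsLT hδ] with t ht ht'
      exact h _ (smul_mem_ann ha ht hw) (ht'.1.trans_eq (hn t ht).symm)
    · filter_upwards [Ioo_mem_nhdsLT hab] with t ht
      exact (hmaps (smul_mem_ann ha ht hw)).2.trans hq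

/-- Along every ray, a homeomorphism between annuli joins the two boundary components. -/
theorem tendsto_norm_or_of_homeomorph {a b c d : ℝ} (ha : 0 ≤ a) (hab : a < b) (hc : 0 ≤ c)
    (hcd : c < d) {f g : E3 → E3} (hf : ContinuousOn f (ann a b)) (hg : ContinuousOn g (ann c d))
    (hfm : MapsTo f (ann a b) (ann c d)) (hgm : MapsTo g (ann c d) (ann a b))
    (hgf : ∀ x ∈ ann a b, g (f x) = x) (hfg : ∀ y ∈ ann c d, f (g y) = y)
    {w : E3} (hw : ‖w‖ = 1) :
    (Filter.Tendsto (fun t : ℝ => ‖f (t • w)‖) (nhdsWithin a (Ioi a)) (nhds c) ∧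
      Filter.Tendsto (fun t : ℝ => ‖f (t • w)‖) (nhdsWithin b (Iio b)) (nhds d)) ∨
    (Filter.Tendsto (fun t : ℝ => ‖f (t • w)‖) (nhdsWithin a (Ioi a)) (nhds d) ∧
      Filter.Tendsto (fun t : ℝ => ‖f (t • w)‖) (nhdsWithin b (Iio b)) (nhds c)) := by
  refine (respectsEnds_or_of_homeomorph ha hab hc hcd hf hg hfm hgm hgf hfg).imp
    (fun h => h.tendsto ha hab (fun x hx => hfm hx) hw) fun h => ?_
  have h' := h.tendsto ha hab (fun x hx => ⟨by linarith [(hfm hx).2], by linarith [(hfm hx).1]⟩) hw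
  have h1 := h'.1.const_sub (c + d)
  have h2 := h'.2.const_sub (c + d)
  simp only [sub_sub_cancel, add_sub_cancel_left, add_sub_cancel_right] at h1 h2
  exact ⟨h1, h2⟩

/-- The image of every ray meets every sphere under a homeomorphism between annuli. -/
theorem exists_norm_eq_of_homeomorph {a b c d : ℝ} (ha : 0 ≤ a) (hab : a < b) (hc : 0 ≤ c)
    (hcd : c < d) {f g : E3 → E3} (hf : ContinuousOn f (ann a b)) (hg : ContinuousOn g (ann c d))
    (hfm : MapsTo f (ann a b) (ann c d)) (hgm : MapsTo g (ann c d) (ann a b))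
    (hgf : ∀ x ∈ ann a b, g (f x) = x) (hfg : ∀ y ∈ ann c d, f (g y) = y)
    {w : E3} (hw : ‖w‖ = 1) {s : ℝ} (hs : s ∈ Ioo c d) :
    ∃ t ∈ Ioo a b, ‖f (t • w)‖ = s := by
  have hcont : ContinuousOn (fun t : ℝ => ‖f (t • w)‖) (Ioo a b) :=
    (hf.comp (by fun_prop) fun t ht => smul_mem_ann ha ht hw).norm
  have hl : nhdsWithin a (Ioi a) ≤ Filter.principal (Ioo a b) :=
    Filter.le_principal_iff.2 (Ioo_mem_nhdsGT hab)
  have hr : nhdsWithin b (Iio b) ≤ Filter.principal (Ioo a b) :=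
    Filter.le_principal_iff.2 (Ioo_mem_nhdsLT hab)
  rcases tendsto_norm_or_of_homeomorph ha hab hc hcd hf hg hfm hgm hgf hfg hw with h | h
  · exact isPreconnected_Ioo.intermediate_value_Ioo hl hr hcont h.1 h.2 hs
  · exact isPreconnected_Ioo.intermediate_value_Ioo hr hl hcont h.2 h.1 hs

/-- The energy of the logarithm of the modulus along each ray. -/
theorem le_lintegral_radial {a b c d : ℝ} (ha : 0 < a) (hab : a < b) (hc : 0 < c)
    (hcd : c < d) {f g : E3 → E3} (hf : ContDiffOn ℝ 1 f (ann a b)) (hg : ContinuousOn g (ann c d))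
    (hfm : MapsTo f (ann a b) (ann c d)) (hgm : MapsTo g (ann c d) (ann a b))
    (hgf : ∀ x ∈ ann a b, g (f x) = x) (hfg : ∀ y ∈ ann c d, f (g y) = y)
    {w : E3} (hw : ‖w‖ = 1) :
    ENNReal.ofReal (a * b * Real.log (d / c) ^ 2 / (b - a)) ≤
      ∫⁻ t in Ioo a b, ENNReal.ofReal (t ^ 2) *
        ENNReal.ofReal ((⟪f (t • w), fderiv ℝ f (t • w) w⟫ / ‖f (t • w)‖ ^ 2) ^ 2) := by
  have hd := hc.trans hcd
  have hmem : ∀ t ∈ Ioo a b, t • w ∈ ann a b := fun t ht => smul_mem_ann ha.le ht hw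
  have hne : ∀ t ∈ Ioo a b, ‖f (t • w)‖ ^ 2 ≠ 0 := fun t ht =>
    pow_ne_zero 2 (hc.trans (hfm (hmem t ht)).1).ne'
  have hcomp : ContinuousOn (fun t : ℝ => f (t • w)) (Ioo a b) :=
    hf.continuousOn.comp (by fun_prop) hmem
  have hcomp' : ContinuousOn (fun t : ℝ => fderiv ℝ f (t • w)) (Ioo a b) :=
    (hf.continuousOn_fderiv_of_isOpen (isOpen_ann a b) le_rfl).comp (by fun_prop) hmem
  have hderiv : ∀ t ∈ Ioo a b, HasDerivAt (fun t : ℝ => Real.log (‖f (t • w)‖ ^ 2) / 2)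
      (⟪f (t • w), fderiv ℝ f (t • w) w⟫ / ‖f (t • w)‖ ^ 2) t := by
    intro t ht
    have hfd : HasFDerivAt f (fderiv ℝ f (t • w)) (t • w) :=
      ((hf.differentiableOn one_ne_zero).differentiableAt
        ((isOpen_ann a b).mem_nhds (hmem t ht))).hasFDerivAt
    have hl : HasDerivAt (fun t : ℝ => t • w) w t := by
      simpa using (hasDerivAt_id t).smul_const w
    refine (((hfd.comp_hasDerivAt t hl).norm_sq.log (hne t ht)).div_const 2).congr_deriv ?_
    rw [mul_div_assoc, mul_div_cancel_left₀ _ two_ne_zero, Function.comp_apply]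
  have hlog : ∀ {l : Filter ℝ} {p : ℝ}, 0 < p →
      Filter.Tendsto (fun t : ℝ => ‖f (t • w)‖) l (nhds p) →
      Filter.Tendsto (fun t : ℝ => Real.log (‖f (t • w)‖ ^ 2) / 2) l (nhds (Real.log p)) := by
    intro l p hp h
    simpa using h.log hp.ne'
  have hcw : ContinuousOn (fun t : ℝ => ⟪f (t • w), fderiv ℝ f (t • w) w⟫ / ‖f (t • w)‖ ^ 2)
      (Ioo a b) :=
    (hcomp.inner (hcomp'.clm_apply continuousOn_const)).div (hcomp.norm.pow 2) hne
  rw [Real.log_div hd.ne' hc.ne']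
  rcases tendsto_norm_or_of_homeomorph ha.le hab hc.le hcd hf.continuousOn hg hfm hgm hgf hfg hw
    with h | h
  · exact ofReal_sq_le_lintegral_sq_mul_deriv ha hab hderiv hcw (hlog hc h.1) (hlog hd h.2)
  · rw [← neg_sub (Real.log c), neg_sq]
    exact ofReal_sq_le_lintegral_sq_mul_deriv ha hab hderiv hcw (hlog hd h.1) (hlog hc h.2)

/-- The total radial energy. -/
theorem le_setLIntegral_radial {a b c d : ℝ} (ha : 0 < a) (hab : a < b) (hc : 0 < c)
    (hcd : c < d) {f g : E3 → E3} (hf : ContDiffOn ℝ 1 f (ann a b)) (hg : ContinuousOn g (ann c d))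
    (hfm : MapsTo f (ann a b) (ann c d)) (hgm : MapsTo g (ann c d) (ann a b))
    (hgf : ∀ x ∈ ann a b, g (f x) = x) (hfg : ∀ y ∈ ann c d, f (g y) = y) :
    ENNReal.ofReal (4 * Real.pi * (a * b * Real.log (d / c) ^ 2 / (b - a))) ≤
      ∫⁻ x in ann a b,
        ENNReal.ofReal ((⟪f x, fderiv ℝ f x (‖x‖⁻¹ • x)⟫ / ‖f x‖ ^ 2) ^ 2) := by
  have hcont : ContinuousOn (fun x : E3 =>
      ENNReal.ofReal ((⟪f x, fderiv ℝ f x (‖x‖⁻¹ • x)⟫ / ‖f x‖ ^ 2) ^ 2)) (ann a b) := by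
    refine ENNReal.continuous_ofReal.comp_continuousOn (ContinuousOn.pow ?_ 2)
    refine (hf.continuousOn.inner ((hf.continuousOn_fderiv_of_isOpen (isOpen_ann a b)
      le_rfl).clm_apply (ContinuousOn.smul (continuous_norm.continuousOn.inv₀ ?_)
      continuousOn_id))).div (hf.continuousOn.norm.pow 2) ?_
    · exact fun x hx => (ha.trans hx.1).ne'
    · exact fun x hx => pow_ne_zero 2 (hc.trans (hfm hx).1).ne'
  have hmeas : Measurable ((ann a b).indicator fun x : E3 =>
      ENNReal.ofReal ((⟪f x, fderiv ℝ f x (‖x‖⁻¹ • x)⟫ / ‖f x‖ ^ 2) ^ 2)) := by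
    classical
    rw [← piecewise_eq_indicator]
    exact hcont.measurable_piecewise continuousOn_const (isOpen_ann a b).measurableSet
  rw [setLIntegral_ann_eq_lintegral_sphere ha.le hmeas, ENNReal.ofReal_mul (by positivity),
    ← toSphere_univ_eq, mul_comm, ← lintegral_const]
  refine lintegral_mono fun w => ?_
  have hw : ‖(w : E3)‖ = 1 := by simp
  refine (le_lintegral_radial ha hab hc hcd hf hg hfm hgm hgf hfg hw).trans_eq
    (setLIntegral_congr_fun measurableSet_Ioo fun t ht => ?_)
  have ht0 := ha.trans ht.1
  simp [norm_smul, abs_of_pos ht0, ht0.ne', smul_smul]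

/-- Rescaling a map so that it preserves the norm. -/
def normalized (f : E3 → E3) (x : E3) : E3 := (‖x‖ / ‖f x‖) • f x

theorem norm_normalized {f : E3 → E3} {x : E3} (h : f x ≠ 0) : ‖normalized f x‖ = ‖x‖ := by
  simp [normalized, norm_smul, h]

theorem hasFDerivAt_normalized {f : E3 → E3} {x : E3} (hf : DifferentiableAt ℝ f x) (hx : x ≠ 0)
    (h : f x ≠ 0) : HasFDerivAt (normalized f) ((‖x‖ / ‖f x‖) • fderiv ℝ f x +
      (fderiv ℝ (fun z => ‖z‖ / ‖f z‖) x).smulRight (f x)) x := by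
  have hq : DifferentiableAt ℝ (fun z => ‖z‖ / ‖f z‖) x := by
    simp only [div_eq_mul_inv]
    exact (differentiableAt_id.norm ℝ hx).fun_mul
      ((hf.norm ℝ h).fun_inv (norm_ne_zero_iff.2 h))
  exact hq.hasFDerivAt.smul hf.hasFDerivAt

theorem inner_fderiv_eq_of_norm_eq {H : E3 → E3} {x : E3} (hH : DifferentiableAt ℝ H x)
    (hn : ∀ᶠ z in nhds x, ‖H z‖ = ‖z‖) (v : E3) : ⟪H x, fderiv ℝ H x v⟫ = ⟪x, v⟫ := by
  have h1 := hH.hasFDerivAt.norm_sq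
  have h2 := (hasFDerivAt_id (𝕜 := ℝ) x).norm_sq
  have h3 := h1.unique (h2.congr_of_eventuallyEq (hn.mono fun z hz => by simp [hz]))
  have h4 := congrArg (fun T : E3 →L[ℝ] ℝ => T v) h3
  simpa using h4

theorem frobSq_lower_bound {a b : ℝ} (ha : 0 ≤ a) {f : E3 → E3}
    (hf : DifferentiableOn ℝ f (ann a b)) (hf0 : ∀ x ∈ ann a b, f x ≠ 0) {x : E3}
    (hx : x ∈ ann a b) :
    (⟪f x, fderiv ℝ f x (‖x‖⁻¹ • x)⟫ / ‖f x‖ ^ 2) ^ 2 +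
      2 * (|(fderiv ℝ (normalized f) x).det| / ‖x‖ ^ 2) ≤ frobSq (fderiv ℝ f x) / ‖f x‖ ^ 2 := by
  have hx0 : x ≠ 0 := norm_pos_iff.1 (ha.trans_lt hx.1)
  have hnhds := (isOpen_ann a b).mem_nhds hx
  have hH := hasFDerivAt_normalized (hf.differentiableAt hnhds) hx0 (hf0 x hx)
  refine radial_add_det_le_frobSq _ hx0 (hf0 x hx) (fderiv ℝ (fun z => ‖z‖ / ‖f z‖) x) _
    (fun v => by rw [hH.fderiv]; rfl)
    (inner_fderiv_eq_of_norm_eq (H := normalized f) hH.differentiableAt ?_)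
  filter_upwards [hnhds] with z hz using norm_normalized (hf0 z hz)

/-- The total tangential energy. -/
theorem le_setLIntegral_tangential {a b c d : ℝ} (ha : 0 < a) (hab : a < b) (hc : 0 < c)
    (hcd : c < d) {f g : E3 → E3} (hf : DifferentiableOn ℝ f (ann a b))
    (hg : ContinuousOn g (ann c d))
    (hfm : MapsTo f (ann a b) (ann c d)) (hgm : MapsTo g (ann c d) (ann a b))
    (hgf : ∀ x ∈ ann a b, g (f x) = x) (hfg : ∀ y ∈ ann c d, f (g y) = y) :
    ENNReal.ofReal (4 * Real.pi * (b - a)) ≤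
      ∫⁻ x in ann a b, ENNReal.ofReal (|(fderiv ℝ (normalized f) x).det| / ‖x‖ ^ 2) := by
  have hf0 : ∀ x ∈ ann a b, f x ≠ 0 := fun x hx => norm_pos_iff.1 (hc.trans (hfm hx).1)
  rw [← setLIntegral_ann_inv_sq ha.le]
  refine (setLIntegral_ann_le_det (H := normalized f)
    (φ := fun t => ENNReal.ofReal (t ^ 2)⁻¹) (fun x hx => ?_)
    (fun x hx => norm_normalized (hf0 x hx)) (fun y hy => ?_) (by fun_prop)).trans_eq ?_
  · exact (hasFDerivAt_normalized (hf.differentiableAt ((isOpen_ann a b).mem_nhds hx))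
      (norm_pos_iff.1 (ha.trans hx.1)) (hf0 x hx)).differentiableAt
  · have hy0 : 0 < ‖y‖ := ha.trans hy.1
    have hw : ‖‖y‖⁻¹ • y‖ = 1 := by simp [norm_smul, hy0.ne']
    obtain ⟨t, ht, hgt⟩ := exists_norm_eq_of_homeomorph hc.le hcd ha.le hab hg hf.continuousOn
      hgm hfm hfg hgf hw hy
    have hmem := smul_mem_ann hc.le ht hw
    have ht0 : 0 < t := hc.trans ht.1
    refine ⟨g (t • ‖y‖⁻¹ • y), hgm hmem, ?_⟩
    rw [normalized, hfg _ hmem, hgt, norm_smul, hw, smul_smul, smul_smul,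
      Real.norm_of_nonneg ht0.le]
    field_simp
    exact one_smul _ _
  · refine lintegral_congr fun x => ?_
    rw [← ENNReal.ofReal_mul (abs_nonneg _), div_eq_mul_inv]

/-- lower bound for the weighted Dirichlet energy of a `C¹` homeomorphism
between the annuli `A(r,R)` and `A(r_*,R_*)` in `ℝ³`. -/
theorem stmt_0 (r R rs Rs : ℝ) (hr : 0 < r) (hrR : r < R) (hrs : 0 < rs) (hRs : rs < Rs)
    (f g : E3 → E3)
    (hf : ContDiffOn ℝ 1 f (ann r R))
    (hbij : Set.BijOn f (ann r R) (ann rs Rs))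
    (hg : ContinuousOn g (ann rs Rs))
    (hgf : ∀ x ∈ ann r R, g (f x) = x) :
    ENNReal.ofReal (4 * Real.pi * (2 * (R - r) + r * R * (Real.log (Rs / rs)) ^ 2 / (R - r)))
      ≤ ∫⁻ x in ann r R, ENNReal.ofReal (frobSq (fderiv ℝ f x) / ‖f x‖ ^ 2) := by
  have hfm := hbij.mapsTo
  have hfg : ∀ y ∈ ann rs Rs, f (g y) = y := fun y hy => by
    obtain ⟨x, hx, rfl⟩ := hbij.surjOn hy
    rw [hgf x hx]
  have hgm : MapsTo g (ann rs Rs) (ann r R) := fun y hy => by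
    obtain ⟨x, hx, rfl⟩ := hbij.surjOn hy
    rwa [hgf x hx]
  have hd := hf.differentiableOn one_ne_zero
  have hrad := le_setLIntegral_radial hr hrR hrs hRs hf hg hfm hgm hgf hfg
  have htan := le_setLIntegral_tangential hr hrR hrs hRs hd hg hfm hgm hgf hfg
  have hpos : 0 < R - r := sub_pos.2 hrR
  have hR := hr.trans hrR
  have hsplit : 4 * Real.pi * (2 * (R - r) + r * R * (Real.log (Rs / rs)) ^ 2 / (R - r)) =
      4 * Real.pi * (r * R * Real.log (Rs / rs) ^ 2 / (R - r)) +
        2 * (4 * Real.pi * (R - r)) := by ring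
  rw [hsplit, ENNReal.ofReal_add (by positivity) (by positivity), ENNReal.ofReal_mul zero_le_two]
  refine (add_le_add hrad (mul_le_mul_right htan _)).trans ?_
  rw [← lintegral_const_mul' _ _ ENNReal.ofReal_ne_top]
  refine (le_lintegral_add _ _).trans
    (setLIntegral_mono' (isOpen_ann r R).measurableSet fun x hx => ?_)
  rw [← ENNReal.ofReal_mul zero_le_two, ← ENNReal.ofReal_add (by positivity) (by positivity)]
  exact ENNReal.ofReal_le_ofReal (frobSq_lower_bound hr.le hd
    (fun z hz => norm_pos_iff.1 (hrs.trans (hfm hz).1)) hx)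

end
end

section
/- Let K = [a₁,b₁] × [a₂,b₂] ⊂ ℝ² be a compact rectangle and let h : K → ℝ³ be a C^1 map whose image is the whole unit sphere 𝕊² = {y ∈ ℝ³ : |y| = 1}. Then ∫_K |∂₁h(u) × ∂₂h(u)| du ≥ 4π, where ∂₁h, ∂₂h are the partial derivatives of h and × is the cross product in ℝ³, and the integral is with respect to Lebesgue measure on ℝ². -/
open MeasureTheory Set
open scoped ENNReal

noncomputable section

abbrev E2 := EuclideanSpace ℝ (Fin 2)
/-- Cross product on `ℝ³` (as `EuclideanSpace ℝ (Fin 3)`). -/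
def cross3 (a b : E3) : E3 :=
  (WithLp.equiv 2 (Fin 3 → ℝ)).symm
    ![a 1 * b 2 - a 2 * b 1, a 2 * b 0 - a 0 * b 2, a 0 * b 1 - a 1 * b 0]

lemma inner_cross3_eq_det (L : E3 →L[ℝ] E3) :
    L.det = inner ℝ (L (EuclideanSpace.single 0 1))
      (cross3 (L (EuclideanSpace.single 1 1)) (L (EuclideanSpace.single 2 1))) := by
  have h : L.det = LinearMap.det (L : E3 →ₗ[ℝ] E3) := rfl
  rw [h, ← LinearMap.det_toMatrix (EuclideanSpace.basisFun (Fin 3) ℝ).toBasis, Matrix.det_fin_three]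
  simp [LinearMap.toMatrix_apply, cross3, PiLp.inner_apply, Fin.sum_univ_three]
  ring

lemma cross3_smul_smul (t : ℝ) (a b : E3) : cross3 (t • a) (t • b) = t ^ 2 • cross3 a b := by
  ext i
  fin_cases i <;> simp [cross3] <;> ring

lemma continuous_cross3 : Continuous fun p : E3 × E3 => cross3 p.1 p.2 := by
  refine (PiLp.continuous_toLp 2 _).comp (continuous_pi fun i => ?_)
  fin_cases i <;> simp <;> fun_prop

/-- The last two coordinates of a vector of `ℝ³`. -/
def tailCLM : E3 →L[ℝ] E2 :=
  LinearMap.toContinuousLinearMap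
    { toFun := fun x => WithLp.toLp 2 fun i => x i.succ
      map_add' := fun x y => by ext i; simp
      map_smul' := fun c x => by ext i; simp }

lemma tailCLM_apply (x : E3) (i : Fin 2) : tailCLM x i = x i.succ := rfl

/-- The splitting of `ℝ³` as `ℝ × ℝ²`. -/
def headTail : E3 ≃ᵐ ℝ × E2 :=
  (MeasurableEquiv.toLp 2 (Fin 3 → ℝ)).symm.trans
    ((MeasurableEquiv.piFinSuccAbove (fun _ : Fin 3 => ℝ) 0).trans
      ((MeasurableEquiv.refl ℝ).prodCongr (MeasurableEquiv.toLp 2 (Fin 2 → ℝ))))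

lemma headTail_apply (x : E3) : headTail x = (x 0, tailCLM x) := rfl

lemma volume_preserving_headTail : MeasurePreserving headTail volume volume :=
  ((MeasurePreserving.id volume).prod (PiLp.volume_preserving_toLp (Fin 2))).comp
    ((volume_preserving_piFinSuccAbove (fun _ : Fin 3 => ℝ) 0).comp
      (EuclideanSpace.volume_preserving_symm_measurableEquiv_toLp (Fin 3)))

/-- The derivative of the cone map `x ↦ x 0 • h (x 1, x 2)`. -/
def coneDeriv (t : ℝ) (y : E3) (D : E2 →L[ℝ] E3) : E3 →L[ℝ] E3 :=
  t • D.comp tailCLM + (EuclideanSpace.proj (𝕜 := ℝ) (0 : Fin 3)).smulRight y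

lemma abs_det_coneDeriv_le (t : ℝ) {y : E3} (hy : ‖y‖ = 1) (D : E2 →L[ℝ] E3) :
    |(coneDeriv t y D).det| ≤ t ^ 2 *
      ‖cross3 (D (EuclideanSpace.single 0 1)) (D (EuclideanSpace.single 1 1))‖ := by
  have e0 : tailCLM (EuclideanSpace.single 0 1) = 0 := by
    ext i; fin_cases i <;> simp [tailCLM_apply]
  have e1 : tailCLM (EuclideanSpace.single 1 1) = EuclideanSpace.single 0 1 := by
    ext i; fin_cases i <;> simp [tailCLM_apply]
  have e2 : tailCLM (EuclideanSpace.single 2 1) = EuclideanSpace.single 1 1 := by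
    ext i; fin_cases i <;> simp [tailCLM_apply]
  rw [inner_cross3_eq_det]
  refine (abs_real_inner_le_norm _ _).trans_eq ?_
  simp [coneDeriv, e0, e1, e2, cross3_smul_smul, norm_smul, hy]

lemma hasFDerivWithinAt_cone {h : E2 → E3} {K : Set E2} (hh : DifferentiableOn ℝ h K) {s : Set E3}
    (hs : MapsTo tailCLM s K) {x : E3} (hx : x ∈ s) :
    HasFDerivWithinAt (fun x : E3 => x 0 • h (tailCLM x))
      (coneDeriv (x 0) (h (tailCLM x)) (fderivWithin ℝ h K (tailCLM x))) s x :=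
  HasFDerivWithinAt.smul
    (EuclideanSpace.proj (𝕜 := ℝ) (0 : Fin 3)).hasFDerivAt.hasFDerivWithinAt
    ((hh _ (hs hx)).hasFDerivWithinAt.comp x tailCLM.hasFDerivAt.hasFDerivWithinAt hs)

lemma lintegral_Icc_sq :
    ∫⁻ t in Icc (0 : ℝ) 1, ENNReal.ofReal (t ^ 2) = ENNReal.ofReal (1 / 3) := by
  rw [← ofReal_integral_eq_lintegral_ofReal
    ((continuous_pow 2).continuousOn.integrableOn_compact isCompact_Icc)
    (Filter.Eventually.of_forall fun t => sq_nonneg t), integral_Icc_eq_integral_Ioc,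
    ← intervalIntegral.integral_of_le zero_le_one, integral_pow]
  norm_num

lemma integrableOn_norm_cross3_fderivWithin {h : E2 → E3} {K : Set E2} (hc : IsCompact K)
    (hconv : Convex ℝ K) (hh : ContDiffOn ℝ 1 h K) :
    IntegrableOn (fun u => ‖cross3 (fderivWithin ℝ h K u (EuclideanSpace.single 0 1))
      (fderivWithin ℝ h K u (EuclideanSpace.single 1 1))‖) K := by
  rcases (interior K).eq_empty_or_nonempty with he | hne
  · have h0 : volume K = 0 := by
      have := hconv.addHaar_frontier (volume : Measure E2)
      rwa [hc.isClosed.frontier_eq, he, sdiff_empty] at this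
    rw [IntegrableOn, Measure.restrict_eq_zero.2 h0]
    exact integrable_zero_measure
  · have hD := hh.continuousOn_fderivWithin (uniqueDiffOn_convex hconv hne) le_rfl
    have hpair : ContinuousOn (fun u => (fderivWithin ℝ h K u (EuclideanSpace.single 0 1),
        fderivWithin ℝ h K u (EuclideanSpace.single 1 1))) K :=
      (hD.clm_apply continuousOn_const).prodMk (hD.clm_apply continuousOn_const)
    exact (continuous_cross3.comp_continuousOn hpair).norm.integrableOn_compact hc

lemma ball_subset_image_cone {h : E2 → E3} {K : Set E2}
    (himg : h '' K = Metric.sphere (0 : E3) 1) :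
    Metric.ball (0 : E3) 1 ⊆
      (fun x : E3 => x 0 • h (tailCLM x)) '' (headTail ⁻¹' (Icc 0 1 ×ˢ K)) := by
  intro y hy
  obtain ⟨v, hv, hyv⟩ : ∃ v ∈ Metric.sphere (0 : E3) 1, ‖y‖ • v = y := by
    rcases eq_or_ne y 0 with rfl | hy0
    · exact ⟨EuclideanSpace.single 0 1, by simp, by simp⟩
    · have := norm_ne_zero_iff.2 hy0
      exact ⟨‖y‖⁻¹ • y, by simp [norm_smul, this], by rw [smul_smul, mul_inv_cancel₀ this, one_smul]⟩
  rw [← himg] at hv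
  obtain ⟨u, hu, rfl⟩ := hv
  have hx := headTail.apply_symm_apply (‖y‖, u)
  have hx' := hx
  rw [headTail_apply, Prod.mk.injEq] at hx'
  refine ⟨headTail.symm (‖y‖, u), ?_, ?_⟩
  · rw [mem_preimage, hx]
    exact ⟨⟨norm_nonneg y, (mem_ball_zero_iff.1 hy).le⟩, hu⟩
  · simp only [hx'.1, hx'.2, hyv]

/-- if a `C¹` map on a compact rectangle `K ⊂ ℝ²` has the whole unit sphere
`𝕊² ⊂ ℝ³` as its image, then the integral of its surface Jacobian over `K` is at least `4π`. -/
theorem stmt_5 (a₁ b₁ a₂ b₂ : ℝ) (h₁ : a₁ ≤ b₁) (h₂ : a₂ ≤ b₂)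
    (K : Set E2) (hK : K = {u : E2 | u 0 ∈ Set.Icc a₁ b₁ ∧ u 1 ∈ Set.Icc a₂ b₂})
    (h : E2 → E3)
    (hh : ContDiffOn ℝ 1 h K)
    (himg : h '' K = Metric.sphere (0 : E3) 1) :
    4 * Real.pi ≤
      ∫ u in K, ‖cross3 (fderivWithin ℝ h K u (EuclideanSpace.single 0 1))
                        (fderivWithin ℝ h K u (EuclideanSpace.single 1 1))‖ := by
  have hKe : K = (EuclideanSpace.equiv (Fin 2) ℝ) ⁻¹' Icc ![a₁, a₂] ![b₁, b₂] := by
    ext u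
    simp [hK, Pi.le_def, Fin.forall_fin_two]
    tauto
  have hc : IsCompact K := by
    rw [hKe]
    exact (EuclideanSpace.equiv (Fin 2) ℝ).toHomeomorph.isCompact_preimage.2 isCompact_Icc
  have hconv : Convex ℝ K := by
    rw [hKe]
    exact (convex_Icc _ _).linear_preimage (EuclideanSpace.equiv (Fin 2) ℝ).toLinearMap
  have hint := integrableOn_norm_cross3_fderivWithin hc hconv hh
  set g : E2 → ℝ := fun u => ‖cross3 (fderivWithin ℝ h K u (EuclideanSpace.single 0 1))
    (fderivWithin ℝ h K u (EuclideanSpace.single 1 1))‖ with hg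
  have hPm : MeasurableSet (Icc (0 : ℝ) 1 ×ˢ K) := measurableSet_Icc.prod hc.measurableSet
  set s : Set E3 := headTail ⁻¹' (Icc 0 1 ×ˢ K) with hs
  have hsm : MeasurableSet s := headTail.measurable hPm
  have hmaps : MapsTo tailCLM s K := fun x hx => hx.2
  have key : ENNReal.ofReal (Real.pi * 4 / 3) ≤ ENNReal.ofReal (1 / 3 * ∫ u in K, g u) :=
    calc ENNReal.ofReal (Real.pi * 4 / 3)
        = volume (Metric.ball (0 : E3) 1) := by simp [EuclideanSpace.volume_ball_fin_three]
      _ ≤ volume ((fun x : E3 => x 0 • h (tailCLM x)) '' s) :=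
        measure_mono (ball_subset_image_cone himg)
      _ ≤ ∫⁻ x in s, ENNReal.ofReal
            |(coneDeriv (x 0) (h (tailCLM x)) (fderivWithin ℝ h K (tailCLM x))).det| :=
        addHaar_image_le_lintegral_abs_det_fderiv volume hsm fun x hx =>
          hasFDerivWithinAt_cone (hh.differentiableOn one_ne_zero) hmaps hx
      _ ≤ ∫⁻ x in s, ENNReal.ofReal ((headTail x).1 ^ 2) * ENNReal.ofReal (g (headTail x).2) := by
        refine setLIntegral_mono' hsm fun x hx => ?_
        rw [← ENNReal.ofReal_mul (sq_nonneg _)]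
        refine ENNReal.ofReal_le_ofReal (abs_det_coneDeriv_le _ ?_ _)
        exact mem_sphere_zero_iff_norm.1 (himg ▸ mem_image_of_mem h (hmaps hx))
      _ = ∫⁻ p in Icc (0 : ℝ) 1 ×ˢ K, ENNReal.ofReal (p.1 ^ 2) * ENNReal.ofReal (g p.2) :=
        volume_preserving_headTail.setLIntegral_comp_preimage_emb headTail.measurableEmbedding
          (fun p => ENNReal.ofReal (p.1 ^ 2) * ENNReal.ofReal (g p.2)) _
      _ = (∫⁻ t in Icc (0 : ℝ) 1, ENNReal.ofReal (t ^ 2)) * ∫⁻ u in K, ENNReal.ofReal (g u) := by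
        rw [Measure.volume_eq_prod, ← Measure.prod_restrict]
        exact lintegral_prod_mul (f := fun t : ℝ => ENNReal.ofReal (t ^ 2)) (by fun_prop)
          hint.aemeasurable.ennreal_ofReal
      _ = ENNReal.ofReal (1 / 3 * ∫ u in K, g u) := by
        rw [lintegral_Icc_sq, ENNReal.ofReal_mul (by norm_num),
          ofReal_integral_eq_lintegral_ofReal hint
            (Filter.Eventually.of_forall fun u => norm_nonneg _)]
  have hnonneg : 0 ≤ ∫ u in K, g u := integral_nonneg fun u => norm_nonneg _
  have := (ENNReal.ofReal_le_ofReal_iff (by positivity)).1 key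
  linarith

end
end

section
/- Let 0 < r < R and let H : (r,R) → (0,∞) be a C² function satisfying 2 H(t) H'(t) − t H'(t)² + t H(t) H''(t) = 0 for all t ∈ (r,R). Then there exist constants a > 0 and b ∈ ℝ such that H(t) = a e^{b/t} for all t ∈ (r,R). -/
open Set

/-- A function whose derivative vanishes on an open interval is constant there. -/
lemma exists_eq_const_of_hasDerivAt_zero {r R : ℝ} {f : ℝ → ℝ}
    (hf : ∀ t ∈ Ioo r R, HasDerivAt f 0 t) : ∃ c, ∀ t ∈ Ioo r R, f t = c :=
  isOpen_Ioo.exists_is_const_of_deriv_eq_zero isPreconnected_Ioo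
    (fun t ht => (hf t ht).differentiableAt.differentiableWithinAt)
    (fun t ht => (hf t ht).deriv)

/-- the positive solutions of `2HH' − tH'² + tHH'' = 0` on `(r,R)` are exactly
the functions `H(t) = a e^{b/t}`. -/
theorem stmt_12 (r R : ℝ) (hr : 0 < r) (hrR : r < R)
    (H : ℝ → ℝ) (hH : ContDiffOn ℝ 2 H (Set.Ioo r R))
    (hpos : ∀ t ∈ Set.Ioo r R, 0 < H t)
    (hode : ∀ t ∈ Set.Ioo r R,
      2 * H t * deriv H t - t * (deriv H t) ^ 2 + t * H t * deriv (deriv H) t = 0) :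
    ∃ a b : ℝ, 0 < a ∧ ∀ t ∈ Set.Ioo r R, H t = a * Real.exp (b / t) := by
  have hH' : ∀ t ∈ Ioo r R, HasDerivAt H (deriv H t) t := fun t ht =>
    ((hH.differentiableOn (by norm_num)).differentiableAt (isOpen_Ioo.mem_nhds ht)).hasDerivAt
  have hH'' : ∀ t ∈ Ioo r R, HasDerivAt (deriv H) (deriv (deriv H) t) t := fun t ht =>
    (((hH.deriv_of_isOpen (m := 1) isOpen_Ioo (by norm_num)).differentiableOn
      (by norm_num)).differentiableAt (isOpen_Ioo.mem_nhds ht)).hasDerivAt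
  obtain ⟨c, hc⟩ : ∃ c, ∀ t ∈ Ioo r R, t ^ 2 * deriv H t / H t = c := by
    refine exists_eq_const_of_hasDerivAt_zero fun t ht => ?_
    have hne := (hpos t ht).ne'
    refine ((((hasDerivAt_id t).pow 2).mul (hH'' t ht)).div (hH' t ht) hne).congr_deriv ?_
    rw [div_eq_zero_iff]
    left
    simp
    linear_combination t * hode t ht
  obtain ⟨a, ha⟩ : ∃ a, ∀ t ∈ Ioo r R, H t * Real.exp (c / t) = a := by
    refine exists_eq_const_of_hasDerivAt_zero fun t ht => ?_
    have hne := (hpos t ht).ne'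
    have ht0 : t ≠ 0 := (hr.trans ht.1).ne'
    refine ((hH' t ht).mul
      ((hasDerivAt_const t c).div (hasDerivAt_id t) ht0).exp).congr_deriv ?_
    have h := hc t ht
    rw [div_eq_iff hne] at h
    simp
    field_simp
    linear_combination Real.exp (c / t) * h
  have hform : ∀ t ∈ Ioo r R, H t = a * Real.exp (-c / t) := fun t ht => by
    rw [← ha t ht, mul_assoc, ← Real.exp_add, neg_div, add_neg_cancel, Real.exp_zero, mul_one]
  obtain ⟨t, ht⟩ := nonempty_Ioo.mpr hrR
  exact ⟨a, -c, ha t ht ▸ mul_pos (hpos t ht) (Real.exp_pos _), hform⟩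
end

section
/- Let 0 < r < R and 0 < r_* < R_*, and let H : [r,R] → (0,∞) be a C^1 function with H(r) = r_* and H(R) = R_*. Then ∫_r^R ( t² H'(t)²/H(t)² + 2 ) dt ≥ 2(R−r) + rR (log(R_*/r_*))²/(R−r). -/
open Set intervalIntegral

/-- A `C¹` function on `[r, R]` with positive values has integrable radial energy density. -/
theorem integrableOn_radial_energy {r R : ℝ} (hrR : r < R) {H : ℝ → ℝ}
    (hH : ContDiffOn ℝ 1 H (Icc r R)) (hpos : ∀ t ∈ Icc r R, 0 < H t) :
    MeasureTheory.IntegrableOn (fun t => t ^ 2 * (deriv H t) ^ 2 / (H t) ^ 2 + 2) (Icc r R) := by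
  have hcont : ContinuousOn
      (fun t => t ^ 2 * (derivWithin H (Icc r R) t) ^ 2 / (H t) ^ 2 + 2) (Icc r R) := by
    have hd := hH.continuousOn_derivWithin (uniqueDiffOn_Icc hrR) le_rfl
    refine ContinuousOn.add (ContinuousOn.div ((continuousOn_id.pow 2).mul (hd.pow 2))
      (hH.continuousOn.pow 2) fun t ht => ?_) continuousOn_const
    exact pow_ne_zero 2 (hpos t ht).ne'
  rw [integrableOn_Icc_iff_integrableOn_Ioo]
  refine (hcont.integrableOn_Icc.mono_set Ioo_subset_Icc_self).congr_fun (fun t ht => ?_)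
    measurableSet_Ioo
  simp only [derivWithin_of_mem_nhds (Icc_mem_nhds ht.1 ht.2)]

/-- lower bound for the radial energy integral. -/
theorem stmt_14 (r R rs Rs : ℝ) (hr : 0 < r) (hrR : r < R) (hrs : 0 < rs) (hRs : rs < Rs)
    (H : ℝ → ℝ) (hH : ContDiffOn ℝ 1 H (Set.Icc r R))
    (hpos : ∀ t ∈ Set.Icc r R, 0 < H t)
    (hHr : H r = rs) (hHR : H R = Rs) :
    2 * (R - r) + r * R * (Real.log (Rs / rs)) ^ 2 / (R - r)
      ≤ ∫ t in r..R, (t ^ 2 * (deriv H t) ^ 2 / (H t) ^ 2 + 2) := by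
  have hR : 0 < R := hr.trans hrR
  have hsub : R - r ≠ 0 := (sub_pos.2 hrR).ne'
  set c : ℝ := r * R * Real.log (Rs / rs) / (R - r) with hc
  have key := sub_le_integral_of_hasDeriv_right_of_le
    (g := fun t => 2 * c * Real.log (H t) + c ^ 2 * t⁻¹ + 2 * t)
    (g' := fun t => 2 * c * (deriv H t / H t) + c ^ 2 * (-(t ^ 2)⁻¹) + 2 * 1)
    hrR.le ?_ (fun t ht => ?_) (integrableOn_radial_energy hrR hH hpos) (fun t ht => ?_)
  · refine le_of_eq_of_le ?_ key
    have hlog : Real.log (H R) = Real.log (Rs / rs) + Real.log (H r) := by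
      rw [hHR, hHr, Real.log_div (hrs.trans hRs).ne' hrs.ne']
      ring
    simp only [hlog, hc]
    field_simp
    ring
  · refine ContinuousOn.add (ContinuousOn.add ?_ ?_) (by fun_prop)
    · exact continuousOn_const.mul (hH.continuousOn.log fun t ht => (hpos t ht).ne')
    · exact continuousOn_const.mul
        (continuousOn_id.inv₀ fun t ht => (hr.trans_le ht.1).ne')
  · have hd : DifferentiableAt ℝ H t :=
      (hH.contDiffAt (Icc_mem_nhds ht.1 ht.2)).differentiableAt one_ne_zero
    exact ((((hd.hasDerivAt.log (hpos t (Ioo_subset_Icc_self ht)).ne').const_mul (2 * c)).add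
      ((hasDerivAt_inv (hr.trans ht.1).ne').const_mul (c ^ 2))).add
      ((hasDerivAt_id t).const_mul 2)).hasDerivWithinAt
  · have ht0 : t ≠ 0 := (hr.trans ht.1).ne'
    have hHt : H t ≠ 0 := (hpos t (Ioo_subset_Icc_self ht)).ne'
    have hsq : t ^ 2 * deriv H t ^ 2 / H t ^ 2 + 2 -
        (2 * c * (deriv H t / H t) + c ^ 2 * (-(t ^ 2)⁻¹) + 2 * 1) =
        (t * (deriv H t / H t) - c / t) ^ 2 := by
      field_simp
      ring
    exact sub_nonneg.1 (hsq ▸ sq_nonneg _)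
end

section
/- Let 0 < r < R and 0 < r_* < R_*, and define H₁ : [r,R] → ℝ by H₁(t) = r_* (R_*/r_*)^{R(t−r)/((R−r)t)}. Then H₁ is strictly increasing with H₁(r) = r_* and H₁(R) = R_*, and ∫_r^R ( t² H₁'(t)²/H₁(t)² + 2 ) dt = 2(R−r) + rR (log(R_*/r_*))²/(R−r). -/
open Set intervalIntegral

/-- The derivative of the exponent `R (t - r) / ((R - r) t)`. -/
lemma hasDerivAt_radialExponent {r R t : ℝ} (hrR : r < R) (ht : 0 < t) :
    HasDerivAt (fun t : ℝ => R * (t - r) / ((R - r) * t)) (R * r / ((R - r) * t ^ 2)) t := by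
  have hd : R - r ≠ 0 := (sub_pos.2 hrR).ne'
  have hnum : HasDerivAt (fun t : ℝ => R * (t - r)) (R * 1) t :=
    ((hasDerivAt_id' t).sub_const r).const_mul R
  have hden : HasDerivAt (fun t : ℝ => (R - r) * t) ((R - r) * 1) t :=
    (hasDerivAt_id' t).const_mul (R - r)
  refine (hnum.fun_div hden (mul_ne_zero hd ht.ne')).congr_deriv ?_
  field_simp
  ring

/-- The exponent `R (t - r) / ((R - r) t)` is strictly increasing on the positive reals. -/
lemma strictMonoOn_radialExponent {r R : ℝ} (hr : 0 < r) (hrR : r < R) :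
    StrictMonoOn (fun t : ℝ => R * (t - r) / ((R - r) * t)) (Set.Ioi 0) := by
  intro s hs t ht hst
  have hs' : 0 < s := hs
  have ht' : 0 < t := ht
  have hd : 0 < R - r := sub_pos.2 hrR
  have hR : 0 < R := hr.trans hrR
  change R * (s - r) / ((R - r) * s) < R * (t - r) / ((R - r) * t)
  rw [div_lt_div_iff₀ (by positivity) (by positivity)]
  have hpos : 0 < R * (R - r) * r * (t - s) := by
    have := sub_pos.2 hst
    positivity
  linarith

/-- The integral of `c / t ^ 2 + 2` over an interval of positive reals. -/
lemma integral_const_div_sq_add_two {r R : ℝ} (hr : 0 < r) (hrR : r < R) (c : ℝ) :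
    ∫ t in r..R, (c / t ^ 2 + 2) = 2 * (R - r) + c * (R - r) / (r * R) := by
  have hR : 0 < R := hr.trans hrR
  have hne : ∀ t ∈ uIcc r R, t ≠ 0 := fun t ht => by
    rw [uIcc_of_le hrR.le] at ht
    exact (hr.trans_le ht.1).ne'
  rw [integral_eq_sub_of_hasDerivAt (f := fun t => 2 * t - c * t⁻¹)]
  · field_simp
    ring
  · intro t ht
    refine (((hasDerivAt_id' t).const_mul 2).sub
      ((hasDerivAt_inv (hne t ht)).const_mul c)).congr_deriv ?_
    ring
  · refine ContinuousOn.intervalIntegrable ?_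
    exact (continuousOn_const.div (continuousOn_id.pow 2)
      fun t ht => pow_ne_zero 2 (hne t ht)).add continuousOn_const

/-- the radial minimizer `H₁(t) = r_* (R_*/r_*)^{R(t−r)/((R−r)t)}` is a strictly
increasing bijection of boundary values which attains the minimal radial energy. -/
theorem stmt_15 (r R rs Rs : ℝ) (hr : 0 < r) (hrR : r < R) (hrs : 0 < rs) (hRs : rs < Rs)
    (H₁ : ℝ → ℝ)
    (hH₁ : ∀ t, H₁ t = rs * (Rs / rs) ^ (R * (t - r) / ((R - r) * t))) :
    StrictMonoOn H₁ (Set.Icc r R) ∧ H₁ r = rs ∧ H₁ R = Rs ∧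
    ∫ t in r..R, (t ^ 2 * (deriv H₁ t) ^ 2 / (H₁ t) ^ 2 + 2)
      = 2 * (R - r) + r * R * (Real.log (Rs / rs)) ^ 2 / (R - r) := by
  have hR : 0 < R := hr.trans hrR
  have hd : R - r ≠ 0 := (sub_pos.2 hrR).ne'
  have hq : 1 < Rs / rs := (one_lt_div hrs).2 hRs
  have hq0 : 0 < Rs / rs := one_pos.trans hq
  refine ⟨?_, ?_, ?_, ?_⟩
  · intro s hs t ht hst
    rw [hH₁, hH₁]
    exact mul_lt_mul_of_pos_left (Real.rpow_lt_rpow_of_exponent_lt hq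
      (strictMonoOn_radialExponent hr hrR (hr.trans_le hs.1) (hr.trans_le ht.1) hst)) hrs
  · simp [hH₁]
  · rw [hH₁, mul_comm R (R - r), div_self (mul_ne_zero hd hR.ne'), Real.rpow_one,
      mul_div_cancel₀ _ hrs.ne']
  · have hcongr : EqOn (fun t => t ^ 2 * (deriv H₁ t) ^ 2 / (H₁ t) ^ 2 + 2)
        (fun t => (R * r * Real.log (Rs / rs) / (R - r)) ^ 2 / t ^ 2 + 2) (uIcc r R) := by
      intro t ht
      rw [uIcc_of_le hrR.le] at ht
      have ht0 : 0 < t := hr.trans_le ht.1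
      have hpos : H₁ t ≠ 0 := by
        rw [hH₁]
        positivity
      have hderiv : deriv H₁ t = H₁ t * (Real.log (Rs / rs) * (R * r / ((R - r) * t ^ 2))) := by
        have h := ((hasDerivAt_radialExponent hrR ht0).const_rpow hq0).const_mul rs
        rw [← funext hH₁] at h
        rw [h.deriv, hH₁]
        ring
      change t ^ 2 * (deriv H₁ t) ^ 2 / (H₁ t) ^ 2 + 2 = _
      rw [hderiv]
      field_simp
    rw [integral_congr hcongr, integral_const_div_sq_add_two hr hrR]
    field_simp
end

section
/- Let 0 < r < R and 0 < r_* < R_*, and let α : [r,R] → ℝ³ \ {0} be a C^1 curve with |α(r)| = r_* and |α(R)| = R_*. Then ∫_r^R t² |α'(t)|²/|α(t)|² dt ≥ rR (log(R_*/r_*))²/(R−r). -/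
open Set intervalIntegral

noncomputable section

/-- lower bound for the weighted length-type energy of a curve joining
the spheres of radii `r_*` and `R_*`. -/
theorem stmt_16 (r R rs Rs : ℝ) (hr : 0 < r) (hrR : r < R) (hrs : 0 < rs) (hRs : rs < Rs)
    (α : ℝ → E3) (hα : ContDiffOn ℝ 1 α (Set.Icc r R))
    (hα0 : ∀ t ∈ Set.Icc r R, α t ≠ 0)
    (hαr : ‖α r‖ = rs) (hαR : ‖α R‖ = Rs) :
    r * R * (Real.log (Rs / rs)) ^ 2 / (R - r)
      ≤ ∫ t in r..R, t ^ 2 * ‖deriv α t‖ ^ 2 / ‖α t‖ ^ 2 := by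
  set L := Real.log (Rs / rs) with hL
  have hL0 : 0 ≤ L := Real.log_nonneg ((one_le_div hrs).2 hRs.le)
  have hRr : 0 < R - r := sub_pos.2 hrR
  have hR : 0 < R := hr.trans hrR
  set c := L * (r * R) / (R - r) with hc
  have hc0 : 0 ≤ c := by positivity
  have hcont : ContinuousOn (fun t ↦ c * Real.log (‖α t‖ ^ 2) + c ^ 2 / t) (Icc r R) := by
    have := hα.continuousOn
    refine ContinuousOn.add (continuousOn_const.mul ?_) ?_
    · exact (this.norm.pow 2).log fun t ht ↦ pow_ne_zero 2 (norm_ne_zero_iff.2 (hα0 t ht))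
    · exact continuousOn_const.div continuousOn_id fun t ht ↦ (hr.trans_le ht.1).ne'
  have hint : MeasureTheory.IntegrableOn
      (fun t ↦ t ^ 2 * ‖deriv α t‖ ^ 2 / ‖α t‖ ^ 2) (Icc r R) := by
    have h : ContinuousOn (fun t ↦ t ^ 2 * ‖derivWithin α (Icc r R) t‖ ^ 2 / ‖α t‖ ^ 2)
        (Icc r R) := by
      have h1 := hα.continuousOn_derivWithin (uniqueDiffOn_Icc hrR) le_rfl
      exact ((continuousOn_id.pow 2).mul (h1.norm.pow 2)).div (hα.continuousOn.norm.pow 2)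
        fun t ht ↦ pow_ne_zero 2 (norm_ne_zero_iff.2 (hα0 t ht))
    rw [integrableOn_Icc_iff_integrableOn_Ioo]
    refine (h.integrableOn_Icc.mono_set Ioo_subset_Icc_self).congr_fun ?_ measurableSet_Ioo
    intro t ht
    simp only [derivWithin_of_mem_nhds (Icc_mem_nhds ht.1 ht.2)]
  have key := sub_le_integral_of_hasDeriv_right_of_le hrR.le hcont
    (g' := fun t ↦ c * (2 * inner ℝ (α t) (deriv α t) / ‖α t‖ ^ 2) + -c ^ 2 / t ^ 2)
    (fun t ht ↦ ?_) hint (fun t ht ↦ ?_)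
  · refine le_trans (le_of_eq ?_) key
    have hlog : L = Real.log Rs - Real.log rs := Real.log_div (hrs.trans hRs).ne' hrs.ne'
    simp only [hαr, hαR, Real.log_pow, Nat.cast_ofNat]
    have : Real.log Rs = L + Real.log rs := by linarith
    rw [this, hc]
    field_simp
    ring
  · have hd : HasDerivAt α (deriv α t) t :=
      ((hα.differentiableOn one_ne_zero).differentiableAt
        (Icc_mem_nhds ht.1 ht.2)).hasDerivAt
    have h1 := (hd.norm_sq.log
      (pow_ne_zero 2 (norm_ne_zero_iff.2 (hα0 t (Ioo_subset_Icc_self ht))))).const_mul c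
    have h2 := (hasDerivAt_inv (hr.trans ht.1).ne').const_mul (c ^ 2)
    simp only [div_eq_mul_inv (c ^ 2)]
    refine (h1.add h2).hasDerivWithinAt.congr_deriv ?_
    ring
  · have ht0 : 0 < t := hr.trans ht.1
    have hn : 0 < ‖α t‖ := norm_pos_iff.2 (hα0 t (Ioo_subset_Icc_self ht))
    have hv : inner ℝ (α t) (deriv α t) / ‖α t‖ ^ 2 ≤ ‖deriv α t‖ / ‖α t‖ := by
      rw [div_le_div_iff₀ (by positivity) hn]
      nlinarith [mul_le_mul_of_nonneg_right (real_inner_le_norm (α t) (deriv α t)) hn.le]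
    have h3 := mul_le_mul_of_nonneg_left hv hc0
    have h4 := sq_nonneg (t * (‖deriv α t‖ / ‖α t‖) - c / t)
    have h5 : (t * (‖deriv α t‖ / ‖α t‖) - c / t) ^ 2 =
        t ^ 2 * ‖deriv α t‖ ^ 2 / ‖α t‖ ^ 2 - 2 * (c * (‖deriv α t‖ / ‖α t‖)) + c ^ 2 / t ^ 2 := by
      field_simp
      ring
    rw [neg_div, mul_div_assoc]
    linarith

end
end

section
/- Let 0 < r < R and 0 < r_* < R_*, and define H : [r,R] → ℝ by H(t) = r²R²(rR_* − Rr_*)/((r³−R³)t²) + (r²r_* − R²R_*)t/(r³−R³). Then H(r) = r_*, H(R) = R_*, and H'(t) ≥ 0 for all t ∈ [r,R] if and only if r_*/R_* ≤ 3rR²/(r³ + 2R³). -/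
open Set

/-- the radial harmonic solution with boundary values `r_*`, `R_*` is
nondecreasing on `[r,R]` iff the generalized Nitsche condition holds. -/
theorem stmt_17 (r R rs Rs : ℝ) (hr : 0 < r) (hrR : r < R) (hrs : 0 < rs) (hRs : rs < Rs)
    (H : ℝ → ℝ)
    (hH : ∀ t, H t = r ^ 2 * R ^ 2 * (r * Rs - R * rs) / ((r ^ 3 - R ^ 3) * t ^ 2)
      + (r ^ 2 * rs - R ^ 2 * Rs) * t / (r ^ 3 - R ^ 3)) :
    H r = rs ∧ H R = Rs ∧
    ((∀ t ∈ Set.Icc r R, 0 ≤ deriv H t) ↔ rs / Rs ≤ 3 * r * R ^ 2 / (r ^ 3 + 2 * R ^ 3)) := by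
  have hR : 0 < R := hr.trans hrR
  have hRs0 : 0 < Rs := hrs.trans hRs
  have hE : 0 < R ^ 3 - r ^ 3 := sub_pos.2 (by gcongr)
  have hD : r ^ 3 - R ^ 3 ≠ 0 := (sub_neg.2 (sub_pos.1 hE)).ne
  have hm : 0 < R ^ 2 * Rs - r ^ 2 * rs := sub_pos.2 (by gcongr)
  have hderiv : ∀ t, 0 < t → deriv H t =
      ((R ^ 2 * Rs - r ^ 2 * rs) * t ^ 3 + 2 * r ^ 2 * R ^ 2 * (r * Rs - R * rs))
        / ((R ^ 3 - r ^ 3) * t ^ 3) := by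
    intro t ht
    have h1 := ((hasDerivAt_const t (r ^ 2 * R ^ 2 * (r * Rs - R * rs))).fun_div
      ((hasDerivAt_pow 2 t).const_mul (r ^ 3 - R ^ 3))
      (mul_ne_zero hD (pow_ne_zero 2 ht.ne'))).fun_add
      (((hasDerivAt_id' t).const_mul (r ^ 2 * rs - R ^ 2 * Rs)).div_const (r ^ 3 - R ^ 3))
    rw [funext hH, h1.deriv]
    have hE' : R ^ 3 - r ^ 3 = -(r ^ 3 - R ^ 3) := by ring
    rw [hE']
    generalize r ^ 3 - R ^ 3 = D at hD
    have := ht.ne'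
    field_simp
    ring
  have hcond : rs / Rs ≤ 3 * r * R ^ 2 / (r ^ 3 + 2 * R ^ 3) ↔
      rs * (r ^ 3 + 2 * R ^ 3) ≤ 3 * r * R ^ 2 * Rs :=
    div_le_div_iff₀ hRs0 (by positivity)
  refine ⟨?_, ?_, ?_⟩
  · rw [hH]
    field_simp
    ring
  · rw [hH]
    field_simp
    ring
  · rw [hcond]
    constructor
    · intro h
      have h1 := h r ⟨le_rfl, hrR.le⟩
      rw [hderiv r hr, le_div_iff₀ (by positivity), zero_mul] at h1
      have h2 : 0 ≤ r ^ 2 * (3 * r * R ^ 2 * Rs - rs * (r ^ 3 + 2 * R ^ 3)) := by linarith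
      exact sub_nonneg.1 (nonneg_of_mul_nonneg_right h2 (by positivity))
    · rintro h t ⟨hrt, -⟩
      have ht : 0 < t := hr.trans_le hrt
      rw [hderiv t ht]
      refine div_nonneg ?_ (by positivity)
      have h1 : (R ^ 2 * Rs - r ^ 2 * rs) * r ^ 3 ≤ (R ^ 2 * Rs - r ^ 2 * rs) * t ^ 3 := by
        gcongr
      have h2 := mul_nonneg (sq_nonneg r) (sub_nonneg.2 h)
      linarith
end

section
/- Let 0 < r < R and 0 < r_* < R_*, define H : [r,R] → ℝ by H(t) = r²R²(rR_* − Rr_*)/((r³−R³)t²) + (r²r_* − R²R_*)t/(r³−R³), and define h : A(r,R) → ℝ³ by h(x) = H(|x|) x/|x|. Then ∫_{A(r,R)} ‖Dh(x)‖² dx = 4π ( r(r³+2R³) r_*² − 6r²R² r_* R_* + R(2r³+R³) R_*² ) / (R³ − r³). -/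
open MeasureTheory Set
open scoped ENNReal RealInnerProductSpace

noncomputable section

/-- The Fréchet derivative of the norm away from the origin. -/
theorem hasFDerivAt_norm_of_ne_zero {F : Type*} [NormedAddCommGroup F] [InnerProductSpace ℝ F]
    {x : F} (hx : x ≠ 0) : HasFDerivAt (fun y : F => ‖y‖) (‖x‖⁻¹ • innerSL ℝ x) x := by
  have hn : ‖x‖ ≠ 0 := norm_ne_zero_iff.mpr hx
  have key := (hasStrictFDerivAt_norm_sq x).hasFDerivAt.sqrt (pow_ne_zero 2 hn)
  simp only [Real.sqrt_sq (norm_nonneg _)] at key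
  convert! key using 1
  ext v
  simp
  field_simp

/-- The derivative of a radial field `y ↦ g ‖y‖ • y` away from the origin. -/
theorem hasFDerivAt_radial {F : Type*} [NormedAddCommGroup F] [InnerProductSpace ℝ F]
    {g : ℝ → ℝ} {g' : ℝ} {x : F} (hx : x ≠ 0) (hg : HasDerivAt g g' ‖x‖) :
    HasFDerivAt (fun y : F => g ‖y‖ • y)
      (g ‖x‖ • ContinuousLinearMap.id ℝ F + ((g' * ‖x‖⁻¹) • innerSL ℝ x).smulRight x) x := by
  have key := (hg.comp_hasFDerivAt x (hasFDerivAt_norm_of_ne_zero hx)).smul (hasFDerivAt_id x)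
  convert! key using 1
  ext v
  simp [mul_assoc]

theorem frobSq_smul_id_add_smulRight (a b : ℝ) (x : E3) :
    frobSq (a • ContinuousLinearMap.id ℝ E3 + (b • innerSL ℝ x).smulRight x)
      = 3 * a ^ 2 + 2 * a * b * ‖x‖ ^ 2 + b ^ 2 * ‖x‖ ^ 4 := by
  have h4 : ‖x‖ ^ 4 = (‖x‖ ^ 2) ^ 2 := by ring
  rw [frobSq, h4]
  simp [EuclideanSpace.norm_sq_eq, Fin.sum_univ_three, EuclideanSpace.inner_single_right]
  ring

theorem measurableSet_ann (a b : ℝ) : MeasurableSet (ann a b) :=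
  (isOpen_lt continuous_const continuous_norm).measurableSet.inter
    (isOpen_lt continuous_norm continuous_const).measurableSet

theorem setIntegral_ann_fun_norm {a b : ℝ} (ha : 0 ≤ a) (hab : a ≤ b) (f : ℝ → ℝ) :
    ∫ x in ann a b, f ‖x‖ = 4 * Real.pi * ∫ t in a..b, t ^ 2 * f t := by
  have hind : (ann a b).indicator (fun x => f ‖x‖) = fun x => (Ioo a b).indicator f ‖x‖ := rfl
  have hsub : Ioo a b ∩ Ioi 0 = Ioo a b := inter_eq_left.mpr fun t ht => ha.trans_lt ht.1
  have hball : (volume : Measure E3).real (Metric.ball 0 1) = Real.pi * 4 / 3 := by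
    rw [Measure.real, EuclideanSpace.volume_ball_fin_three]
    simp
    positivity
  have hfun : (fun t : ℝ => t ^ 2 * (Ioo a b).indicator f t)
      = (Ioo a b).indicator fun t => t ^ 2 * f t := by
    ext t
    simp [indicator]
  rw [← integral_indicator (measurableSet_ann a b), hind, integral_fun_norm_addHaar, hball,
    finrank_euclideanSpace_fin]
  simp only [smul_eq_mul, nsmul_eq_mul, Nat.add_one_sub_one]
  rw [hfun, setIntegral_indicator measurableSet_Ioo, inter_comm, hsub,
    intervalIntegral.integral_of_le hab, integral_Ioc_eq_integral_Ioo]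
  push_cast
  ring

theorem frobSq_fderiv_radial {A B : ℝ} {x : E3} (hx : x ≠ 0) :
    frobSq (fderiv ℝ (fun y : E3 => (A / ‖y‖ ^ 3 + B) • y) x)
      = 6 * A ^ 2 / ‖x‖ ^ 6 + 3 * B ^ 2 := by
  have hn : ‖x‖ ≠ 0 := norm_ne_zero_iff.mpr hx
  have hg : HasDerivAt (fun t : ℝ => A / t ^ 3 + B) (-3 * A / ‖x‖ ^ 4) ‖x‖ := by
    convert! (((hasDerivAt_const ‖x‖ A).div (hasDerivAt_pow 3 ‖x‖) (pow_ne_zero 3 hn)).add_const B)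
      using 1
    field_simp
    norm_num [mul_comm]
  rw [(hasFDerivAt_radial hx hg).fderiv, frobSq_smul_id_add_smulRight]
  field_simp
  ring

theorem integral_sq_mul_energy_density {r R : ℝ} (hr : 0 < r) (hrR : r ≤ R) (A B : ℝ) :
    ∫ t in r..R, t ^ 2 * (6 * A ^ 2 / t ^ 6 + 3 * B ^ 2)
      = 2 * A ^ 2 * (1 / r ^ 3 - 1 / R ^ 3) + B ^ 2 * (R ^ 3 - r ^ 3) := by
  have hne : ∀ t ∈ uIcc r R, t ≠ 0 := fun t ht => by
    rw [uIcc_of_le hrR] at ht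
    exact (hr.trans_le ht.1).ne'
  rw [intervalIntegral.integral_eq_sub_of_hasDerivAt
    (f := fun t => B ^ 2 * t ^ 3 - 2 * A ^ 2 / t ^ 3)]
  · ring
  · intro t ht
    have h0 := hne t ht
    convert! ((hasDerivAt_pow 3 t).const_mul (B ^ 2)).sub
      ((hasDerivAt_const t (2 * A ^ 2)).div (hasDerivAt_pow 3 t) (pow_ne_zero 3 h0)) using 1
    field_simp
    norm_num
    ring
  · refine ContinuousOn.intervalIntegrable fun t ht => ContinuousAt.continuousWithinAt ?_
    have h0 := hne t ht
    fun_prop (disch := positivity)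

/-- the Dirichlet energy of the radial harmonic map between the annuli. -/
theorem stmt_18 (r R rs Rs : ℝ) (hr : 0 < r) (hrR : r < R) (hrs : 0 < rs) (hRs : rs < Rs)
    (H : ℝ → ℝ)
    (hH : ∀ t, H t = r ^ 2 * R ^ 2 * (r * Rs - R * rs) / ((r ^ 3 - R ^ 3) * t ^ 2)
      + (r ^ 2 * rs - R ^ 2 * Rs) * t / (r ^ 3 - R ^ 3))
    (h : E3 → E3) (hh : ∀ x, h x = H ‖x‖ • (‖x‖⁻¹ • x)) :
    ∫ x in ann r R, frobSq (fderiv ℝ h x)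
      = 4 * Real.pi * (r * (r ^ 3 + 2 * R ^ 3) * rs ^ 2 - 6 * r ^ 2 * R ^ 2 * rs * Rs
          + R * (2 * r ^ 3 + R ^ 3) * Rs ^ 2) / (R ^ 3 - r ^ 3) := by
  have hR : 0 < R := hr.trans hrR
  have hpow : r ^ 3 < R ^ 3 := pow_lt_pow_left₀ hrR hr.le (by norm_num)
  have hd : r ^ 3 - R ^ 3 ≠ 0 := (sub_neg.mpr hpow).ne
  have hd' : R ^ 3 - r ^ 3 ≠ 0 := (sub_pos.mpr hpow).ne'
  set A := r ^ 2 * R ^ 2 * (r * Rs - R * rs) / (r ^ 3 - R ^ 3) with hA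
  set B := (r ^ 2 * rs - R ^ 2 * Rs) / (r ^ 3 - R ^ 3) with hB
  have hfun : h = fun y => (A / ‖y‖ ^ 3 + B) • y := by
    ext1 y
    rcases eq_or_ne y 0 with rfl | hy
    · simp [hh]
    · have hn : ‖y‖ ≠ 0 := norm_ne_zero_iff.mpr hy
      rw [hh, hH, smul_smul, hA, hB]
      congr 1
      field_simp
  have hcongr : ∫ x in ann r R, frobSq (fderiv ℝ h x)
      = ∫ x in ann r R, (fun t : ℝ => 6 * A ^ 2 / t ^ 6 + 3 * B ^ 2) ‖x‖ := by
    refine setIntegral_congr_fun (measurableSet_ann r R) fun x hx => ?_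
    rw [hfun]
    exact frobSq_fderiv_radial (norm_pos_iff.mp (hr.trans hx.1))
  rw [hcongr, setIntegral_ann_fun_norm hr.le hrR.le fun t => 6 * A ^ 2 / t ^ 6 + 3 * B ^ 2,
    integral_sq_mul_energy_density hr hrR.le,
    hA, hB, ← neg_sub (R ^ 3) (r ^ 3)]
  field_simp
  ring

end
end
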